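/- arXiv:math/9308208 — 2 statements merged into one kernel-verified Lean document; each statement's English description precedes it below -/
import Mathlib

section
/- Let A be a commutative unital C*-algebra and E ⊆ A a closed subspace, let B be a C*-algebra and F ⊆ B an exact closed subspace. Then every tracially bounded linear map u : E → F* is 2-absolutely summing with π₂(u) ≤ 4·d_SK(F)·‖u‖_tb. -/
open scoped ComplexOrder

noncomputable section

/-- The norm of an element of a unital complex `*`-algebra computed spectrally: the square
root of the spectral radius of `star a * a`.  On a unital C*-algebra this coincides with
the norm, and on the matrix algebra `Mₙ(A)` over a unital C*-algebra `A` it is the unique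
C*-norm of `Mₙ(A)`. -/
def cstarNorm {A : Type*} [Ring A] [Algebra ℂ A] [Star A] (a : A) : ℝ :=
  Real.sqrt (spectralRadius ℂ (star a * a)).toReal

/-- The norm of a matrix with entries in a subspace `E` of `A` (the subspace being given by
the embedding `ι : E →ₗ A`), i.e. the norm of `Mₙ(E)` inherited from the C*-algebra
`Mₙ(A)`. -/
def matNorm {A : Type*} [Ring A] [Algebra ℂ A] [StarRing A]
    {E : Type*} [AddCommGroup E] [Module ℂ E] (ι : E →ₗ[ℂ] A)
    {n : ℕ} (x : Matrix (Fin n) (Fin n) E) : ℝ :=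
  cstarNorm (x.map fun e => ι e)

/-- `RCBound ι v C` : the map `v`, defined on the subspace `E ⊆ A` given by the embedding
`ι`, is `(2,RC)`-summing with constant `C`, i.e. for every finite family `(x₁,…,xₙ)` in `E`
one has `∑ ‖v xᵢ‖² ≤ C² · RC((xᵢ))`, where
`RC((xᵢ)) = max(‖∑ xᵢ xᵢ*‖, ‖∑ xᵢ* xᵢ‖)`.  "`v` is `(2,RC)`-summing with
`π_{2,RC}(v) ≤ C`" is expressed by `RCBound ι v C`. -/
def RCBound {A : Type*} [NormedRing A] [StarRing A] [NormedAlgebra ℂ A]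
    {E : Type*} [AddCommGroup E] [Module ℂ E] (ι : E →ₗ[ℂ] A)
    {Y : Type*} [NormedAddCommGroup Y] [NormedSpace ℂ Y] (v : E →ₗ[ℂ] Y) (C : ℝ) : Prop :=
  ∀ (n : ℕ) (x : Fin n → E),
    ∑ i, ‖v (x i)‖ ^ 2 ≤
      C ^ 2 * max ‖∑ i, ι (x i) * star (ι (x i))‖ ‖∑ i, star (ι (x i)) * ι (x i)‖

/-- The set of numbers `|(1/n) ∑_{ij} ⟨φ(x_{ij}), y_{ij}⟩|` over all `n ≥ 1` and all
matrices `x ∈ Mₙ(E)`, `y ∈ Mₙ(F)` of norm at most 1 (the subspaces `E ⊆ A`, `F ⊆ B` being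
given by the embeddings `ι`, `κ`, and `φ` being the bilinear pairing associated to a map
`E → F*`).  Its supremum is the tracially bounded norm `‖·‖_tb`, and the pairing is
tracially bounded iff this set is bounded above. -/
def tbSet {A B : Type*} [NormedRing A] [StarRing A] [NormedAlgebra ℂ A]
    [NormedRing B] [StarRing B] [NormedAlgebra ℂ B]
    {E F : Type*} [AddCommGroup E] [Module ℂ E] [AddCommGroup F] [Module ℂ F]
    (ι : E →ₗ[ℂ] A) (κ : F →ₗ[ℂ] B) (φ : E →ₗ[ℂ] F →ₗ[ℂ] ℂ) : Set ℝ :=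
  {r | ∃ n : ℕ, 0 < n ∧ ∃ (x : Matrix (Fin n) (Fin n) E) (y : Matrix (Fin n) (Fin n) F),
    matNorm ι x ≤ 1 ∧ matNorm κ y ≤ 1 ∧
    r = ‖(n : ℂ)⁻¹ * ∑ i, ∑ j, φ (x i j) (y i j)‖}

/-- The bilinear pairing `E × F → ℂ` associated to a linear map `u : E → F*`. -/
def dualPairing {F' E : Type*} [NormedAddCommGroup F'] [NormedSpace ℂ F']
    [AddCommGroup E] [Module ℂ E]
    (u : E →ₗ[ℂ] (F' →L[ℂ] ℂ)) : E →ₗ[ℂ] F' →ₗ[ℂ] ℂ :=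
  (ContinuousLinearMap.coeLM ℂ).comp u

/-- The set of norms of amplifications defining the completely bounded norm of a linear
map `v : E → F` between subspaces of `*`-algebras (given by embeddings `ι`, `κ`): the
norms `‖(v(x_{ij}))‖_{Mₙ(B)}` over matrices `x ∈ Mₙ(E)` of norm at most 1. -/
def cbNormSet {A B : Type*} [Ring A] [Algebra ℂ A] [StarRing A]
    [Ring B] [Algebra ℂ B] [StarRing B]
    {E F : Type*} [AddCommGroup E] [Module ℂ E] [AddCommGroup F] [Module ℂ F]
    (ι : E →ₗ[ℂ] A) (κ : F →ₗ[ℂ] B) (v : E →ₗ[ℂ] F) : Set ℝ :=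
  {r | ∃ (n : ℕ) (x : Matrix (Fin n) (Fin n) E),
    matNorm ι x ≤ 1 ∧ r = matNorm κ (x.map fun e => v e)}

/-- The completely bounded norm `‖v‖_cb` of a linear map between subspaces of
`*`-algebras. -/
def cbNorm {A B : Type*} [Ring A] [Algebra ℂ A] [StarRing A]
    [Ring B] [Algebra ℂ B] [StarRing B]
    {E F : Type*} [AddCommGroup E] [Module ℂ E] [AddCommGroup F] [Module ℂ F]
    (ι : E →ₗ[ℂ] A) (κ : F →ₗ[ℂ] B) (v : E →ₗ[ℂ] F) : ℝ :=
  sSup (cbNormSet ι κ v)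

/-- `d_SK(G)` for a (finite-dimensional) subspace `G` of a C*-algebra: the infimum of
`‖v‖_cb ‖v⁻¹‖_cb` over all linear isomorphisms `v` from `G` onto a subspace of a matrix
algebra `M_N(ℂ)`. -/
def dSKfin {A : Type*} [NormedRing A] [StarRing A] [NormedAlgebra ℂ A]
    (G : Submodule ℂ A) : ℝ :=
  sInf {c | ∃ (N : ℕ) (Fm : Submodule ℂ (Matrix (Fin N) (Fin N) ℂ)) (v : ↥G ≃ₗ[ℂ] ↥Fm),
    c = cbNorm G.subtype Fm.subtype v.toLinearMap *
        cbNorm Fm.subtype G.subtype v.symm.toLinearMap}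

/-- The set of values `d_SK(G)` over finite-dimensional subspaces `G ⊆ E`. -/
def dSKSet {A : Type*} [NormedRing A] [StarRing A] [NormedAlgebra ℂ A]
    (E : Submodule ℂ A) : Set ℝ :=
  {r | ∃ G : Submodule ℂ A, G ≤ E ∧ FiniteDimensional ℂ ↥G ∧ r = dSKfin G}

/-- `d_SK(E) = sup { d_SK(G) : G ⊆ E finite-dimensional }`. -/
def dSK {A : Type*} [NormedRing A] [StarRing A] [NormedAlgebra ℂ A]
    (E : Submodule ℂ A) : ℝ := sSup (dSKSet E)

/-- A subspace `E` of a C*-algebra is exact if `d_SK(E) < ∞`, i.e. the values `d_SK(G)`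
over finite-dimensional `G ⊆ E` are bounded above. -/
def IsExactSubspace {A : Type*} [NormedRing A] [StarRing A] [NormedAlgebra ℂ A]
    (E : Submodule ℂ A) : Prop := BddAbove (dSKSet E)

/-- `Pi2Bound v C` : the linear map `v` between normed spaces is 2-absolutely summing
with constant `C`, i.e. for every finite family `(x₁,…,xₙ)`,
`∑ ‖v xᵢ‖² ≤ C² · sup{∑ |ξ xᵢ|² : ξ ∈ X*, ‖ξ‖ ≤ 1}`.  "`v` is 2-absolutely summing with
`π₂(v) ≤ C`" is expressed by `Pi2Bound v C`. -/
def Pi2Bound {X : Type*} [NormedAddCommGroup X] [NormedSpace ℂ X]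
    {Y : Type*} [NormedAddCommGroup Y] [NormedSpace ℂ Y] (v : X →ₗ[ℂ] Y) (C : ℝ) : Prop :=
  ∀ (n : ℕ) (x : Fin n → X),
    ∑ i, ‖v (x i)‖ ^ 2 ≤
      C ^ 2 * sSup {r | ∃ ξ : X →L[ℂ] ℂ, ‖ξ‖ ≤ 1 ∧ r = ∑ i, ‖ξ (x i)‖ ^ 2}

/-- The element of the free group obtained by deleting the first letter of the reduced word. -/
def freeParent {α : Type*} [DecidableEq α] (w : FreeGroup α) : FreeGroup α :=
  FreeGroup.mk w.toWord.tail

theorem freeParent_letter_mul {α : Type*} [DecidableEq α] (l : α × Bool) (w : FreeGroup α) :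
    freeParent (FreeGroup.mk [l] * w) = w ∨ FreeGroup.mk [l] * w = freeParent w := by
  have h : (FreeGroup.mk [l] * w).toWord = FreeGroup.reduce (l :: w.toWord) := by
    conv_lhs => rw [← FreeGroup.mk_toWord (x := w), FreeGroup.mul_mk, FreeGroup.toWord_mk]
    rfl
  rw [FreeGroup.reduce.cons, FreeGroup.reduce_toWord] at h
  rcases hw : w.toWord with _ | ⟨hd, tl⟩
  · left
    rw [hw] at h
    rw [freeParent, h, ← FreeGroup.mk_toWord (x := w), hw]
    rfl
  · rw [hw] at h
    simp only at h
    split_ifs at h with hc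
    · right
      rw [freeParent, hw, List.tail_cons, ← h, FreeGroup.mk_toWord]
    · left
      rw [freeParent, h, List.tail_cons, ← hw, FreeGroup.mk_toWord]

/-- A finite subset of a free group acts separately at every point of some finite free action. -/
theorem exists_perm_rep_injOn {α : Type*} (T : Finset (FreeGroup α)) :
    ∃ n : ℕ, 0 < n ∧ ∃ ρ : FreeGroup α →* Equiv.Perm (Fin n),
      ∀ x, Set.InjOn (fun w => ρ w x) (T : Set (FreeGroup α)) := by
  classical
  let B : Finset (FreeGroup α) :=
    insert 1 (T.biUnion fun w => (w.toWord.tails.map FreeGroup.mk).toFinset)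
  have hB1 : (1 : FreeGroup α) ∈ B := Finset.mem_insert_self _ _
  let e (i : α) : {z : B // FreeGroup.of i * (z : FreeGroup α) ∈ B} ≃
      {z : B // (FreeGroup.of i)⁻¹ * (z : FreeGroup α) ∈ B} :=
    { toFun := fun z => ⟨⟨FreeGroup.of i * z, z.2⟩, by simp⟩
      invFun := fun z => ⟨⟨(FreeGroup.of i)⁻¹ * z, z.2⟩, by simp⟩
      left_inv := fun z => by simp
      right_inv := fun z => by simp }
  let σ (i : α) : Equiv.Perm B := (e i).extendSubtype
  have hσ (i : α) (z : B) (h : FreeGroup.of i * (z : FreeGroup α) ∈ B) :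
      σ i z = ⟨FreeGroup.of i * z, h⟩ :=
    Equiv.extendSubtype_apply_of_mem (e i) z h
  let Φ : FreeGroup α →* Equiv.Perm B := FreeGroup.lift σ
  have key (L : List (α × Bool)) (hL : ∀ L', L' <:+ L → FreeGroup.mk L' ∈ B) :
      ((Φ (FreeGroup.mk L) ⟨1, hB1⟩ : B) : FreeGroup α) = FreeGroup.mk L := by
    induction L with
    | nil =>
      have : (FreeGroup.mk [] : FreeGroup α) = 1 := rfl
      rw [this, map_one]; rfl
    | cons l L ih =>
      have ih' := ih fun L' h => hL L' (h.trans (List.suffix_cons l L))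
      have hmem : FreeGroup.mk (l :: L) ∈ B := hL _ List.suffix_rfl
      have hmem' : FreeGroup.mk L ∈ B := hL _ (List.suffix_cons l L)
      have hprod : FreeGroup.mk (l :: L) = FreeGroup.mk [l] * FreeGroup.mk L := by
        rw [FreeGroup.mul_mk]; rfl
      have ih'' : Φ (FreeGroup.mk L) ⟨1, hB1⟩ = ⟨FreeGroup.mk L, hmem'⟩ := Subtype.ext ih'
      obtain ⟨i, b⟩ := l
      rw [hprod, map_mul, Equiv.Perm.mul_apply, ih'']
      rw [hprod] at hmem
      cases b with
      | true =>
        have h1 : Φ (FreeGroup.mk [(i, true)]) = σ i := FreeGroup.lift_apply_of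
        rw [h1, hσ i _ hmem]
        rfl
      | false =>
        have h0 : (FreeGroup.mk [(i, false)] : FreeGroup α) = (FreeGroup.of i)⁻¹ := rfl
        have h1 : Φ (FreeGroup.of i) = σ i := FreeGroup.lift_apply_of
        rw [h0] at hmem ⊢
        rw [map_inv, h1]
        have : σ i ⟨_, hmem⟩ = ⟨FreeGroup.mk L, hmem'⟩ := by
          rw [hσ i ⟨_, hmem⟩ (by simpa using hmem')]
          simp
        rw [← this]
        exact congrArg Subtype.val ((σ i).symm_apply_apply _)
  have hΦ : Set.InjOn Φ (T : Set (FreeGroup α)) := by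
    have h (w : FreeGroup α) (hw : w ∈ T) :
        ((Φ w ⟨1, hB1⟩ : B) : FreeGroup α) = w := by
      have := key w.toWord fun L' hL' => by
        refine Finset.mem_insert_of_mem (Finset.mem_biUnion.2 ⟨w, hw, ?_⟩)
        simp only [List.mem_toFinset, List.mem_map, List.mem_tails]
        exact ⟨L', hL', rfl⟩
      rwa [FreeGroup.mk_toWord] at this
    intro w hw w' hw' hww
    rw [← h w hw, ← h w' hw', hww]
  let ε := Fintype.equivFin (Equiv.Perm B)
  refine ⟨Fintype.card (Equiv.Perm B), Fintype.card_pos,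
    (ε.permCongrHom.toMonoidHom.comp (MulAction.toPermHom (Equiv.Perm B) (Equiv.Perm B))).comp Φ,
    fun x w hw w' hw' h => hΦ hw hw' ?_⟩
  simpa [Equiv.permCongrHom, Equiv.permCongr_apply] using h

/-- The squared Euclidean norm of a finitely indexed complex vector. -/
def nsq {ι : Type*} [Fintype ι] (f : ι → ℂ) : ℝ := ∑ i, ‖f i‖ ^ 2

theorem nsq_nonneg {ι : Type*} [Fintype ι] (f : ι → ℂ) : 0 ≤ nsq f :=
  Finset.sum_nonneg fun _ _ => by positivity

@[simp]
theorem nsq_zero {ι : Type*} [Fintype ι] : nsq (0 : ι → ℂ) = 0 := by simp [nsq]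

theorem nsq_eq_norm_sq {ι : Type*} [Fintype ι] (f : ι → ℂ) : nsq f = ‖WithLp.toLp 2 f‖ ^ 2 := by
  rw [EuclideanSpace.norm_sq_eq]; rfl

theorem nsq_add_le {ι : Type*} [Fintype ι] (f g : ι → ℂ) :
    nsq (f + g) ≤ 2 * nsq f + 2 * nsq g := by
  have h := parallelogram_law_with_norm ℂ (WithLp.toLp 2 f) (WithLp.toLp 2 g)
  rw [nsq_eq_norm_sq, nsq_eq_norm_sq, nsq_eq_norm_sq, WithLp.toLp_add]
  nlinarith [sq_nonneg ‖WithLp.toLp 2 f - WithLp.toLp 2 g‖]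

theorem nsq_single {ι : Type*} [Fintype ι] [DecidableEq ι] (i : ι) (z : ℂ) :
    nsq (Pi.single i z) = ‖z‖ ^ 2 := by
  rw [nsq, Finset.sum_eq_single i]
  · simp
  · intro j _ hj; simp [Pi.single_eq_of_ne hj]
  · simp

theorem nsq_smul {ι : Type*} [Fintype ι] (c : ℂ) (f : ι → ℂ) :
    nsq (c • f) = ‖c‖ ^ 2 * nsq f := by
  simp [nsq, mul_pow, Finset.mul_sum]

theorem star_dotProduct_self {ι : Type*} [Fintype ι] (f : ι → ℂ) :
    star f ⬝ᵥ f = (nsq f : ℂ) := by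
  simp [nsq, dotProduct, Complex.conj_mul']

theorem norm_dotProduct_le {ι : Type*} [Fintype ι] (f g : ι → ℂ) :
    ‖star f ⬝ᵥ g‖ ≤ √(nsq f) * √(nsq g) := by
  have h := norm_inner_le_norm (𝕜 := ℂ) (WithLp.toLp 2 f) (WithLp.toLp 2 g)
  rw [nsq_eq_norm_sq, nsq_eq_norm_sq, Real.sqrt_sq (norm_nonneg _), Real.sqrt_sq (norm_nonneg _)]
  rwa [EuclideanSpace.inner_eq_star_dotProduct, dotProduct_comm] at h

theorem two_mul_re_dotProduct_le {ι : Type*} [Fintype ι] (f g : ι → ℂ) :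
    2 * (star f ⬝ᵥ g).re ≤ nsq f + nsq g := by
  have h1 := (Complex.re_le_norm _).trans (norm_dotProduct_le f g)
  nlinarith [sq_nonneg (√(nsq f) - √(nsq g)), Real.sq_sqrt (nsq_nonneg f),
    Real.sq_sqrt (nsq_nonneg g)]

/-- The family `b` is a contractive column of matrices. -/
def ColContractive {m N : ℕ} (b : Fin m → Matrix (Fin N) (Fin N) ℂ) : Prop :=
  ∀ ξ, ∑ i, nsq ((b i).mulVec ξ) ≤ nsq ξ

/-- The family `b` is a contractive row of matrices. -/
def RowContractive {m N : ℕ} (b : Fin m → Matrix (Fin N) (Fin N) ℂ) : Prop :=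
  ∀ η : Fin m → Fin N → ℂ, nsq (∑ i, (b i).mulVec (η i)) ≤ ∑ i, nsq (η i)

theorem ColContractive.row {m N : ℕ} {b : Fin m → Matrix (Fin N) (Fin N) ℂ}
    (hb : ColContractive fun i => (b i).conjTranspose) : RowContractive b := by
  intro η
  set ζ := ∑ i, (b i).mulVec (η i) with hζ
  have h1 : (nsq ζ : ℂ) = ∑ i, star ((b i).conjTranspose.mulVec ζ) ⬝ᵥ η i := by
    rw [← star_dotProduct_self]
    conv_lhs => rw [hζ, dotProduct_sum]
    refine Finset.sum_congr rfl fun i _ => ?_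
    rw [← hζ, Matrix.star_mulVec, Matrix.conjTranspose_conjTranspose, Matrix.dotProduct_mulVec]
  have h2 : 2 * nsq ζ ≤ ∑ i, (nsq ((b i).conjTranspose.mulVec ζ) + nsq (η i)) := by
    have : nsq ζ = ∑ i, (star ((b i).conjTranspose.mulVec ζ) ⬝ᵥ η i).re := by
      rw [← Complex.re_sum, ← h1, Complex.ofReal_re]
    rw [this, Finset.mul_sum]
    exact Finset.sum_le_sum fun i _ => two_mul_re_dotProduct_le _ _
  rw [Finset.sum_add_distrib] at h2
  linarith [hb ζ]

theorem RowContractive.sum_finset {m N : ℕ} {b : Fin m → Matrix (Fin N) (Fin N) ℂ}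
    (hb : RowContractive b) (s : Finset (Fin m)) (η : Fin m → Fin N → ℂ) :
    nsq (∑ i ∈ s, (b i).mulVec (η i)) ≤ ∑ i ∈ s, nsq (η i) := by
  have := hb fun i => if i ∈ s then η i else 0
  simpa [Finset.sum_ite_mem, apply_ite nsq, apply_ite (Matrix.mulVec (b _))] using this

/-- The operator `f ↦ ∑ i, b i • (s i)_* f` on finitely supported vector valued functions. -/
def stepOp {X : Type*} {m N : ℕ} (s : Fin m → X → X) (b : Fin m → Matrix (Fin N) (Fin N) ℂ)
    (f : X →₀ (Fin N → ℂ)) : X →₀ (Fin N → ℂ) :=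
  ∑ i, (f.mapDomain (s i)).mapRange (b i).mulVec (Matrix.mulVec_zero _)

theorem stepOp_mapDomain {X Y : Type*} {m N : ℕ} (s : Fin m → X → X) (t : Fin m → Y → Y)
    (θ : X → Y) (h : ∀ i x, θ (s i x) = t i (θ x)) (b : Fin m → Matrix (Fin N) (Fin N) ℂ)
    (f : X →₀ (Fin N → ℂ)) :
    stepOp t b (f.mapDomain θ) = (stepOp s b f).mapDomain θ := by
  rw [stepOp, stepOp, Finsupp.mapDomain_finsetSum]
  refine Finset.sum_congr rfl fun i _ => ?_
  rw [Finsupp.mapDomain_mapRange _ _ _ _ fun x y => Matrix.mulVec_add _ x y,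
    ← Finsupp.mapDomain_comp, ← Finsupp.mapDomain_comp]
  congr 2
  funext x
  exact (h i x).symm

theorem stepOp_apply {X : Type*} {m N : ℕ} (s : Fin m → Equiv.Perm X)
    (b : Fin m → Matrix (Fin N) (Fin N) ℂ) (f : X →₀ (Fin N → ℂ)) (x : X) :
    stepOp (fun i => s i) b f x = ∑ i, (b i).mulVec (f ((s i).symm x)) := by
  rw [stepOp, Finsupp.finsetSum_apply]
  refine Finset.sum_congr rfl fun i _ => ?_
  rw [Finsupp.mapRange_apply, Finsupp.mapDomain_equiv_apply]

/-- The total energy of a vector valued function. -/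
def energy {X : Type*} {N : ℕ} (f : X → Fin N → ℂ) : ENNReal :=
  ∑' x, ENNReal.ofReal (nsq (f x))

/-- The operator `∑ i, b i ⊗ s i` has norm at most `2` when the `s i` move along a rooted forest. -/
theorem energy_stepOp_le {X : Type*} {m N : ℕ} (s : Fin m → Equiv.Perm X)
    (hs : ∀ x, Function.Injective fun i => s i x)
    (hs' : ∀ x, Function.Injective fun i => (s i).symm x)
    (parent : X → X) (hp : ∀ i x, parent (s i x) = x ∨ s i x = parent x)
    {b : Fin m → Matrix (Fin N) (Fin N) ℂ} (hc : ColContractive b) (hr : RowContractive b)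
    (f : X →₀ (Fin N → ℂ)) :
    energy (stepOp (fun i => s i) b f) ≤ 4 * energy f := by
  classical
  let O (x : X) : Finset (Fin m) := {i | parent x = (s i).symm x}
  have hO (x : X) : nsq (∑ i ∈ O x, (b i).mulVec (f ((s i).symm x))) ≤
      ∑ i, nsq ((b i).mulVec (f ((s i).symm x))) := by
    rcases (O x).eq_empty_or_nonempty with h | ⟨j, hj⟩
    · rw [h, Finset.sum_empty, nsq_zero]
      exact Finset.sum_nonneg fun _ _ => nsq_nonneg _
    · have : O x = {j} := by
        refine Finset.eq_singleton_iff_unique_mem.2 ⟨hj, fun i hi => hs' x ?_⟩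
        exact (Finset.mem_filter.1 hi).2.symm.trans (Finset.mem_filter.1 hj).2
      rw [this, Finset.sum_singleton]
      exact Finset.single_le_sum (f := fun i => nsq ((b i).mulVec (f ((s i).symm x))))
        (fun _ _ => nsq_nonneg _) (Finset.mem_univ j)
  have hI (x : X) : nsq (∑ i ∈ (O x)ᶜ, (b i).mulVec (f ((s i).symm x))) ≤
      ∑ i, if x = parent ((s i).symm x) then nsq (f ((s i).symm x)) else 0 := by
    refine (hr.sum_finset _ _).trans ?_
    rw [← Finset.sum_filter]
    refine Finset.sum_le_sum_of_subset_of_nonneg (fun i hi => ?_) fun _ _ _ => nsq_nonneg _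
    simp only [O, Finset.mem_compl, Finset.mem_filter, Finset.mem_univ, true_and] at hi ⊢
    have := hp i ((s i).symm x)
    rw [Equiv.apply_symm_apply] at this
    exact this.resolve_left hi
  have hpt (x : X) : ENNReal.ofReal (nsq (stepOp (fun i => s i) b f x)) ≤
      2 * (∑ i, ENNReal.ofReal (nsq ((b i).mulVec (f ((s i).symm x))))) +
      2 * ∑ i, ENNReal.ofReal
        (if x = parent ((s i).symm x) then nsq (f ((s i).symm x)) else 0) := by
    rw [← ENNReal.ofReal_sum_of_nonneg fun _ _ => nsq_nonneg _,
      ← ENNReal.ofReal_sum_of_nonneg fun _ _ => by split_ifs <;> simp [nsq_nonneg]]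
    rw [← ENNReal.ofReal_ofNat, ← ENNReal.ofReal_mul (by norm_num),
      ← ENNReal.ofReal_mul (by norm_num), ← ENNReal.ofReal_add
        (mul_nonneg (by norm_num) (Finset.sum_nonneg fun _ _ => nsq_nonneg _))
        (mul_nonneg (by norm_num) (Finset.sum_nonneg fun _ _ => by
          split_ifs <;> simp [nsq_nonneg]))]
    refine ENNReal.ofReal_le_ofReal ?_
    rw [stepOp_apply, ← Finset.sum_add_sum_compl (O x)]
    have := nsq_add_le (∑ i ∈ O x, (b i).mulVec (f ((s i).symm x)))
      (∑ i ∈ (O x)ᶜ, (b i).mulVec (f ((s i).symm x)))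
    linarith [hO x, hI x]
  calc energy (stepOp (fun i => s i) b f)
      ≤ ∑' x, (2 * (∑ i, ENNReal.ofReal (nsq ((b i).mulVec (f ((s i).symm x))))) +
        2 * ∑ i, ENNReal.ofReal
          (if x = parent ((s i).symm x) then nsq (f ((s i).symm x)) else 0)) :=
        ENNReal.tsum_le_tsum hpt
    _ = 2 * (∑' x, ∑ i, ENNReal.ofReal (nsq ((b i).mulVec (f x)))) +
        2 * ∑' x, ∑ i, ENNReal.ofReal (if s i x = parent x then nsq (f x) else 0) := by
        rw [ENNReal.tsum_add, ENNReal.tsum_mul_left, ENNReal.tsum_mul_left]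
        congr 2
        · rw [Summable.tsum_finsetSum fun _ _ => ENNReal.summable,
            Summable.tsum_finsetSum fun _ _ => ENNReal.summable]
          exact Finset.sum_congr rfl fun i _ =>
            (s i).symm.tsum_eq fun x => ENNReal.ofReal (nsq ((b i).mulVec (f x)))
        · rw [Summable.tsum_finsetSum fun _ _ => ENNReal.summable,
            Summable.tsum_finsetSum fun _ _ => ENNReal.summable]
          refine Finset.sum_congr rfl fun i _ => ?_
          have := (s i).symm.tsum_eq
            fun x => ENNReal.ofReal (if s i x = parent x then nsq (f x) else 0)
          simpa using this
    _ ≤ 2 * energy f + 2 * energy f := by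
        gcongr 2 * ?_ + 2 * ?_
        · refine ENNReal.tsum_le_tsum fun x => ?_
          rw [← ENNReal.ofReal_sum_of_nonneg fun _ _ => nsq_nonneg _]
          exact ENNReal.ofReal_le_ofReal (hc _)
        · refine ENNReal.tsum_le_tsum fun x => ?_
          rw [← ENNReal.ofReal_sum_of_nonneg fun _ _ => by split_ifs <;> simp [nsq_nonneg]]
          refine ENNReal.ofReal_le_ofReal ?_
          rw [← Finset.sum_filter, Finset.sum_const, nsmul_eq_mul]
          refine mul_le_of_le_one_left (nsq_nonneg _) ?_
          exact_mod_cast Finset.card_le_one.2 fun i hi j hj => by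
            have h1 : s i x = parent x := by simpa using hi
            have h2 : s j x = parent x := by simpa using hj
            exact hs x (h1.trans h2.symm)
    _ = 4 * energy f := by ring

/-- The matrix of the permutation operator `δ_x ↦ δ_{σ x}`. -/
def pushMat {n : ℕ} (σ : Equiv.Perm (Fin n)) : Matrix (Fin n) (Fin n) ℂ :=
  Matrix.of fun z x => if σ x = z then 1 else 0

theorem conjTranspose_pushMat {n : ℕ} (σ : Equiv.Perm (Fin n)) :
    (pushMat σ).conjTranspose = pushMat σ⁻¹ := by
  ext z x
  simp only [pushMat, Matrix.conjTranspose_apply, Matrix.of_apply, apply_ite star, star_one,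
    star_zero, Equiv.Perm.inv_eq_iff_eq]
  simp only [eq_comm]

theorem pushMat_mulVec {n : ℕ} (σ : Equiv.Perm (Fin n)) (ξ : Fin n → ℂ) (z : Fin n) :
    (pushMat σ).mulVec ξ z = ξ (σ.symm z) := by
  simp [pushMat, Matrix.mulVec, dotProduct, ← Equiv.eq_symm_apply]

/-- The matrix `∑ i, s i ⊗ b i` for permutations `s i`. -/
def permOp {m n N : ℕ} (s : Fin m → Equiv.Perm (Fin n)) (b : Fin m → Matrix (Fin N) (Fin N) ℂ) :
    Matrix (Fin n × Fin N) (Fin n × Fin N) ℂ :=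
  ∑ i, Matrix.kronecker (pushMat (s i)) (b i)

theorem conjTranspose_permOp {m n N : ℕ} (s : Fin m → Equiv.Perm (Fin n))
    (b : Fin m → Matrix (Fin N) (Fin N) ℂ) :
    (permOp s b).conjTranspose = permOp (fun i => (s i)⁻¹) fun i => (b i).conjTranspose := by
  simp only [permOp, Matrix.conjTranspose_sum, Matrix.kronecker, Matrix.conjTranspose_kronecker,
    conjTranspose_pushMat]

theorem permOp_mulVec {m n N : ℕ} (s : Fin m → Equiv.Perm (Fin n))
    (b : Fin m → Matrix (Fin N) (Fin N) ℂ) (f : Fin n →₀ (Fin N → ℂ)) :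
    (permOp s b).mulVec (Function.uncurry f) =
      Function.uncurry (stepOp (fun i => s i) b f) := by
  ext ⟨z, k⟩
  rw [Function.uncurry_apply_pair, stepOp_apply, permOp, Matrix.sum_mulVec, Finset.sum_apply,
    Finset.sum_apply]
  refine Finset.sum_congr rfl fun i _ => ?_
  simp only [Matrix.mulVec, dotProduct, Fintype.sum_prod_type, Matrix.kronecker,
    Matrix.kroneckerMap_apply, pushMat, Matrix.of_apply, ite_mul, one_mul, zero_mul,
    ← Equiv.eq_symm_apply, Function.uncurry_apply_pair]
  rw [Finset.sum_comm]
  simp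

theorem nsq_uncurry {n N : ℕ} (f : Fin n → Fin N → ℂ) :
    nsq (Function.uncurry f) = ∑ x, nsq (f x) := by
  simp [nsq, Fintype.sum_prod_type]

theorem energy_mapDomain {X : Type*} {n N : ℕ} (θ : X → Fin n) (g : X →₀ (Fin N → ℂ))
    (hθ : Set.InjOn θ g.support) :
    energy g = ENNReal.ofReal (nsq (Function.uncurry (g.mapDomain θ))) := by
  classical
  rw [nsq_uncurry, ENNReal.ofReal_sum_of_nonneg fun _ _ => nsq_nonneg _, energy,
    tsum_eq_sum (s := g.support) fun x hx => by rw [Finsupp.notMem_support_iff.1 hx]; simp,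
    ← Finset.sum_subset (Finset.subset_univ (g.mapDomain θ).support) fun x _ hx => by
      rw [Finsupp.notMem_support_iff.1 hx]; simp, Finsupp.mapDomain_support_of_injOn _ hθ,
    Finset.sum_image hθ]
  exact Finset.sum_congr rfl fun x hx => by
    rw [Finsupp.mapDomain_apply' _ _ subset_rfl hθ hx]

/-- The operators `∑ i, λ i ⊗ a i` on the free group have norm at most `2`; this is visible on
finite permutation models. -/
theorem exists_finset_nsq_pow_le {m N : ℕ} {a : Fin m → Matrix (Fin N) (Fin N) ℂ}
    (ha : ColContractive a) (ha' : ColContractive fun i => (a i).conjTranspose) (Q : ℕ) :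
    ∃ T : Finset (FreeGroup (Fin m)), ∀ (n : ℕ) (ρ : FreeGroup (Fin m) →* Equiv.Perm (Fin n)),
      (∀ x, Set.InjOn (fun w => ρ w x) (T : Set (FreeGroup (Fin m)))) → ∀ p : Fin n × Fin N,
        nsq ((((permOp (fun i => ρ (FreeGroup.of i)) a).conjTranspose *
          permOp (fun i => ρ (FreeGroup.of i)) a) ^ Q).mulVec (Pi.single p 1)) ≤ 16 ^ Q := by
  classical
  let s (i : Fin m) : Equiv.Perm (FreeGroup (Fin m)) := Equiv.mulLeft (FreeGroup.of i)
  let s' (i : Fin m) : Equiv.Perm (FreeGroup (Fin m)) := Equiv.mulLeft (FreeGroup.of i)⁻¹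
  let S (f : FreeGroup (Fin m) →₀ (Fin N → ℂ)) : FreeGroup (Fin m) →₀ (Fin N → ℂ) :=
    stepOp (fun i => s' i) (fun i => (a i).conjTranspose) (stepOp (fun i => s i) a f)
  have hs (x) : Function.Injective fun i => s i x := fun i j h =>
    FreeGroup.of_injective (mul_right_cancel h)
  have hs' (x) : Function.Injective fun i => s' i x := fun i j h =>
    FreeGroup.of_injective (inv_injective (mul_right_cancel h))
  have hss (i) : (s i).symm = s' i := by ext; simp [s, s']
  have hss' (i) : (s' i).symm = s i := by ext; simp [s, s']
  have ha'' : ColContractive fun i => ((a i).conjTranspose).conjTranspose := by simpa using ha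
  have hS (f) : energy (S f) ≤ 16 * energy f := by
    have h1 := energy_stepOp_le s hs (fun x => by simpa only [hss] using hs' x) freeParent
      (fun i x => freeParent_letter_mul (i, true) x) ha ha'.row f
    have h2 := energy_stepOp_le s' hs' (fun x => by simpa only [hss'] using hs x) freeParent
      (fun i x => freeParent_letter_mul (i, false) x) ha' ha''.row (stepOp (fun i => s i) a f)
    refine h2.trans ((mul_le_mul_right h1 4).trans_eq ?_)
    rw [← mul_assoc]; norm_num
  have hSQ (Q : ℕ) (f) : energy (S^[Q] f) ≤ 16 ^ Q * energy f := by
    induction Q with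
    | zero => simp
    | succ Q ih =>
      rw [Function.iterate_succ_apply']
      refine (hS _).trans ((mul_le_mul_right ih 16).trans_eq ?_)
      rw [pow_succ, ← mul_assoc, mul_comm (16 : ENNReal)]
  let f (k : Fin N) : FreeGroup (Fin m) →₀ (Fin N → ℂ) := Finsupp.single 1 (Pi.single k 1)
  have hf (k) : energy (f k) = 1 := by
    rw [energy, tsum_eq_single 1]
    · simp [f, nsq_single]
    · intro w hw; simp [f, Finsupp.single_eq_of_ne hw]
  refine ⟨Finset.univ.biUnion fun k => (S^[Q] (f k)).support, fun n ρ hρ p => ?_⟩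
  obtain ⟨x, k⟩ := p
  let θ (w : FreeGroup (Fin m)) : Fin n := ρ w x
  have hstep (g : FreeGroup (Fin m) →₀ (Fin N → ℂ)) :
      ((permOp (fun i => ρ (FreeGroup.of i)) a).conjTranspose *
        permOp (fun i => ρ (FreeGroup.of i)) a).mulVec (Function.uncurry (g.mapDomain θ)) =
        Function.uncurry ((S g).mapDomain θ) := by
    rw [← Matrix.mulVec_mulVec, permOp_mulVec, conjTranspose_permOp, permOp_mulVec,
      stepOp_mapDomain (fun i => s i) _ θ fun i w => by simp [θ, s],
      stepOp_mapDomain (fun i => s' i) _ θ fun i w => by simp [θ, s']]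
  have hpow (Q : ℕ) (g : FreeGroup (Fin m) →₀ (Fin N → ℂ)) :
      (((permOp (fun i => ρ (FreeGroup.of i)) a).conjTranspose *
        permOp (fun i => ρ (FreeGroup.of i)) a) ^ Q).mulVec (Function.uncurry (g.mapDomain θ)) =
        Function.uncurry ((S^[Q] g).mapDomain θ) := by
    induction Q with
    | zero => simp
    | succ Q ih => rw [pow_succ', ← Matrix.mulVec_mulVec, ih, hstep, Function.iterate_succ_apply']
  have h1 : (Pi.single (x, k) 1 : Fin n × Fin N → ℂ) =
      Function.uncurry ((f k).mapDomain θ) := by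
    ext ⟨y, l⟩
    simp only [f, Finsupp.mapDomain_single, θ, map_one, Equiv.Perm.one_apply,
      Function.uncurry_apply_pair, Finsupp.single_apply, Pi.single_apply, Prod.mk.injEq]
    rcases eq_or_ne y x with rfl | hy
    · simp [Pi.single_apply]
    · simp [hy, hy.symm]
  have h2 := energy_mapDomain θ (S^[Q] (f k)) ((hρ x).mono fun w hw => by
    simp only [Finset.coe_biUnion, Set.mem_iUnion]
    exact ⟨k, Finset.mem_coe.2 (Finset.mem_univ k), hw⟩)
  have h3 := hSQ Q (f k)
  rw [hf, mul_one, h2, ← ENNReal.ofReal_ofNat, ← ENNReal.ofReal_pow (by norm_num)] at h3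
  rw [h1, hpow]
  exact (ENNReal.ofReal_le_ofReal_iff (by positivity)).1 h3

theorem star_mulVec_dotProduct {ι κ : Type*} [Fintype ι] [Fintype κ] (K : Matrix κ ι ℂ)
    (f : κ → ℂ) (g : ι → ℂ) :
    star f ⬝ᵥ K.mulVec g = star (K.conjTranspose.mulVec f) ⬝ᵥ g := by
  rw [Matrix.star_mulVec, Matrix.conjTranspose_conjTranspose, Matrix.dotProduct_mulVec]

theorem nsq_mulVec_le_add_pow {ι : Type*} [Fintype ι] [DecidableEq ι] (V : Matrix ι ι ℂ) {Q : ℕ}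
    (hQ : 0 < Q) (ζ : ι → ℂ) :
    nsq (V.mulVec ζ) ≤ nsq ζ + nsq (((V.conjTranspose * V) ^ Q).mulVec ζ) := by
  set H := V.conjTranspose * V with hH
  have hHp : H.PosSemidef := Matrix.posSemidef_conjTranspose_mul_self V
  let μ (j : ℕ) : ℝ := (star ζ ⬝ᵥ (H ^ j).mulVec ζ).re
  have hconv (j : ℕ) : 2 * μ (j + 1) ≤ μ j + μ (j + 2) := by
    have h1 : ((1 - H) * H ^ j * (1 - H)).PosSemidef := by
      have := (hHp.pow j).mul_mul_conjTranspose_same (1 - H)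
      rwa [Matrix.conjTranspose_sub, Matrix.conjTranspose_one, hHp.isHermitian.eq] at this
    have h2 : (1 - H) * H ^ j * (1 - H) = H ^ j - H ^ (j + 1) - H ^ (j + 1) + H ^ (j + 2) := by
      have hc : H * H ^ j = H ^ j * H := (Commute.self_pow H j).eq
      simp only [pow_add, pow_one, pow_two, sub_mul, mul_sub, one_mul, mul_one, hc, mul_assoc]
      abel
    have h3 := (Complex.le_def.1 (h1.dotProduct_mulVec_nonneg ζ)).1
    rw [h2, Matrix.add_mulVec, Matrix.sub_mulVec, Matrix.sub_mulVec, dotProduct_add,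
      dotProduct_sub, dotProduct_sub, Complex.add_re, Complex.sub_re, Complex.sub_re] at h3
    simp only [Complex.zero_re] at h3
    linarith
  have hmono (j : ℕ) : μ 1 - μ 0 ≤ μ (j + 1) - μ j := by
    induction j with
    | zero => exact le_rfl
    | succ j ih => linarith [hconv j]
  have h0 : μ 0 = nsq ζ := by simp [μ, star_dotProduct_self]
  have h1 : μ 1 = nsq (V.mulVec ζ) := by
    simp only [μ, pow_one, hH]
    rw [← Matrix.mulVec_mulVec, star_mulVec_dotProduct, Matrix.conjTranspose_conjTranspose,
      star_dotProduct_self, Complex.ofReal_re]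
  have h2 : μ (2 * Q) = nsq ((H ^ Q).mulVec ζ) := by
    simp only [μ]
    rw [two_mul, pow_add, ← Matrix.mulVec_mulVec, star_mulVec_dotProduct,
      (hHp.pow Q).isHermitian.eq, star_dotProduct_self, Complex.ofReal_re]
  rw [← h0, ← h1, ← h2]
  rcases le_total (μ 1) (μ 0) with h | h
  · have : 0 ≤ μ (2 * Q) := h2 ▸ nsq_nonneg _
    linarith
  · have h3 (j : ℕ) : μ 1 ≤ μ (j + 1) := by
      induction j with
      | zero => exact le_rfl
      | succ j ih => linarith [hmono (j + 1)]
    have h4 := h3 (2 * Q - 1)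
    rw [show 2 * Q - 1 + 1 = 2 * Q by omega] at h4
    have : 0 ≤ μ 0 := h0 ▸ nsq_nonneg _
    linarith

/-- The resolvent `(1 + KᴴK)⁻¹` and its basic estimates. -/
theorem exists_resolvent {ι κ : Type*} [Fintype ι] [DecidableEq ι] [Fintype κ]
    (K : Matrix κ ι ℂ) :
    ∃ q : Matrix ι ι ℂ, (∀ ξ, nsq (q.mulVec ξ) + nsq (K.mulVec (q.mulVec ξ)) ≤ nsq ξ) ∧
      ∀ ξ, nsq ((1 - q).mulVec ξ) ≤ nsq (K.mulVec ξ) := by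
  have hZ : (1 + K.conjTranspose * K).PosDef :=
    Matrix.PosDef.one.add_posSemidef (Matrix.posSemidef_conjTranspose_mul_self K)
  obtain ⟨q, hq⟩ := hZ.isUnit.exists_right_inv
  have hξ (ξ : ι → ℂ) :
      ξ = q.mulVec ξ + K.conjTranspose.mulVec (K.mulVec (q.mulVec ξ)) := by
    conv_lhs => rw [← Matrix.one_mulVec ξ, ← hq]
    rw [add_mul, one_mul, Matrix.add_mulVec, Matrix.mulVec_mulVec,
      Matrix.mulVec_mulVec]
  refine ⟨q, fun ξ => ?_, fun ξ => ?_⟩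
  · set w := q.mulVec ξ with hw
    have h1 : (star w ⬝ᵥ ξ).re = nsq w + nsq (K.mulVec w) := by
      conv_lhs => rw [hξ ξ, ← hw]
      rw [dotProduct_add, star_mulVec_dotProduct K.conjTranspose, Matrix.conjTranspose_conjTranspose,
        star_dotProduct_self, star_dotProduct_self]
      simp
    have h2 := two_mul_re_dotProduct_le w ξ
    linarith [nsq_nonneg (K.mulVec w)]
  · set w := q.mulVec ξ with hw
    set r := (1 - q).mulVec ξ with hr
    have hr' : r = K.conjTranspose.mulVec (K.mulVec w) := by
      rw [hr, Matrix.sub_mulVec, Matrix.one_mulVec, sub_eq_iff_eq_add', ← hw]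
      exact hξ ξ
    have hrw : ξ = w + r := by rw [hr']; exact hξ ξ
    have h1 : (star ξ ⬝ᵥ r).re = nsq (K.mulVec w) + nsq r := by
      conv_lhs => rw [hrw, star_add, add_dotProduct, star_dotProduct_self]
      conv_lhs => rw [hr', star_mulVec_dotProduct, Matrix.conjTranspose_conjTranspose,
        star_dotProduct_self, ← hr']
      simp
    have h2 : (star ξ ⬝ᵥ r) = star (K.mulVec ξ) ⬝ᵥ K.mulVec w := by
      rw [hr', star_mulVec_dotProduct, Matrix.conjTranspose_conjTranspose]
    have h3 := two_mul_re_dotProduct_le (K.mulVec ξ) (K.mulVec w)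
    rw [← h2, h1] at h3
    linarith [nsq_nonneg r, nsq_nonneg (K.mulVec w), nsq_nonneg (K.mulVec ξ)]

theorem nsq_prod {ι κ : Type*} [Fintype ι] [Fintype κ] (ζ : ι × κ → ℂ) :
    nsq ζ = ∑ k, nsq fun x => ζ (x, k) := by
  simp [nsq, Fintype.sum_prod_type_right]

theorem kronecker_one_mulVec {ι κ : Type*} [Fintype ι] [Fintype κ] [DecidableEq κ]
    (q : Matrix ι ι ℂ) (ζ : ι × κ → ℂ) (k : κ) :
    (fun x => (Matrix.kronecker q (1 : Matrix κ κ ℂ)).mulVec ζ (x, k)) =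
      q.mulVec fun x => ζ (x, k) := by
  ext x
  simp [Matrix.mulVec, dotProduct, Matrix.kronecker, Fintype.sum_prod_type, Matrix.one_apply]

theorem norm_sum_sq_le {ι : Type*} [Fintype ι] (f : ι → ℂ) :
    ‖∑ i, f i‖ ^ 2 ≤ Fintype.card ι * ∑ i, ‖f i‖ ^ 2 := by
  refine (pow_le_pow_left₀ (norm_nonneg _) (norm_sum_le _ _) 2).trans ?_
  simpa using sq_sum_le_card_mul_sum_sq (s := Finset.univ) (f := fun i => ‖f i‖)

/-- A small perturbation of the identity which cuts `V` down to norm at most `c`. -/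
theorem exists_cut {ι κ : Type*} [Fintype ι] [DecidableEq ι] [Fintype κ] [DecidableEq κ]
    (V D : Matrix (ι × κ) (ι × κ) ℂ) {c M : ℝ}
    (hV : ∀ ζ, nsq (V.mulVec ζ) ≤ c ^ 2 * (nsq ζ + nsq (D.mulVec ζ)))
    (hD : ∀ p, nsq (D.mulVec (Pi.single p 1)) ≤ M) :
    ∃ q : Matrix ι ι ℂ, ∑ y, nsq ((1 - q).mulVec (Pi.single y 1)) ≤
        Fintype.card κ ^ 2 * Fintype.card ι * M ∧
      (∀ ξ, nsq (q.mulVec ξ) ≤ nsq ξ) ∧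
      ∀ ζ, nsq (V.mulVec ((Matrix.kronecker q (1 : Matrix κ κ ℂ)).mulVec ζ)) ≤
        c ^ 2 * nsq ζ := by
  let K : Matrix ((ι × κ) × κ) ι ℂ :=
    Matrix.of fun p x => (√(Fintype.card κ : ℝ) : ℂ) * D p.1 (x, p.2)
  have hK (ξ : ι → ℂ) (p : ι × κ) (l : κ) : ‖K.mulVec ξ (p, l)‖ ^ 2 =
      Fintype.card κ * ‖∑ x, D p (x, l) * ξ x‖ ^ 2 := by
    simp only [Matrix.mulVec, dotProduct, K, Matrix.of_apply, mul_assoc, ← Finset.mul_sum]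
    rw [norm_mul, mul_pow, Complex.norm_real, Real.norm_of_nonneg (Real.sqrt_nonneg _),
      Real.sq_sqrt (Nat.cast_nonneg _)]
  have hDK (ζ : ι × κ → ℂ) : nsq (D.mulVec ζ) ≤ ∑ k, nsq (K.mulVec fun x => ζ (x, k)) := by
    have h1 (p : ι × κ) : ‖D.mulVec ζ p‖ ^ 2 ≤
        ∑ k, ∑ l, ‖K.mulVec (fun x => ζ (x, k)) (p, l)‖ ^ 2 := by
      have h2 : D.mulVec ζ p = ∑ l, ∑ x, D p (x, l) * ζ (x, l) := by
        simp [Matrix.mulVec, dotProduct, Fintype.sum_prod_type_right]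
      rw [h2]
      refine (norm_sum_sq_le _).trans ?_
      rw [Finset.mul_sum]
      refine Finset.sum_le_sum fun l _ => ?_
      rw [← hK (fun x => ζ (x, l))]
      exact Finset.single_le_sum
        (f := fun l' => ‖K.mulVec (fun x => ζ (x, l)) (p, l')‖ ^ 2)
        (fun _ _ => by positivity) (Finset.mem_univ l)
    calc nsq (D.mulVec ζ) ≤ ∑ p, ∑ k, ∑ l, ‖K.mulVec (fun x => ζ (x, k)) (p, l)‖ ^ 2 :=
          Finset.sum_le_sum fun p _ => h1 p
      _ = _ := by
          rw [Finset.sum_comm]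
          simp [nsq, Fintype.sum_prod_type (γ := _) (α₁ := ι × κ)]
  obtain ⟨q, hq, hq'⟩ := exists_resolvent K
  refine ⟨q, ?_, fun ξ => ?_, fun ζ => ?_⟩
  · have h1 (y : ι) : nsq ((1 - q).mulVec (Pi.single y 1)) ≤ Fintype.card κ ^ 2 * M := by
      refine (hq' _).trans ?_
      have h2 (l : κ) : ∑ p, ‖D p (y, l)‖ ^ 2 ≤ M := by
        simpa [nsq] using hD (y, l)
      calc nsq (K.mulVec (Pi.single y 1)) =
            Fintype.card κ * ∑ l, ∑ p, ‖D p (y, l)‖ ^ 2 := by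
            rw [nsq, Fintype.sum_prod_type_right, Finset.mul_sum]
            refine Finset.sum_congr rfl fun l _ => ?_
            rw [Finset.mul_sum]
            refine Finset.sum_congr rfl fun p _ => ?_
            rw [hK]
            simp [Pi.single_apply]
        _ ≤ Fintype.card κ * ∑ l : κ, M := by gcongr; exact h2 _
        _ = _ := by simp; ring
    refine (Finset.sum_le_sum fun y _ => h1 y).trans_eq ?_
    simp; ring
  · linarith [hq ξ, nsq_nonneg (K.mulVec (q.mulVec ξ))]
  · refine (hV _).trans (mul_le_mul_of_nonneg_left ?_ (sq_nonneg c))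
    refine (add_le_add_right (hDK _) _).trans ?_
    rw [nsq_prod, nsq_prod ζ, ← Finset.sum_add_distrib]
    simp only [kronecker_one_mulVec]
    exact Finset.sum_le_sum fun k _ => hq _

theorem exists_finset_cut {m N : ℕ} {a : Fin m → Matrix (Fin N) (Fin N) ℂ}
    (ha : ColContractive a) (ha' : ColContractive fun i => (a i).conjTranspose) {c δ : ℝ}
    (hc : 2 < c) (hδ : 0 < δ) :
    ∃ T : Finset (FreeGroup (Fin m)), ∀ (n : ℕ) (ρ : FreeGroup (Fin m) →* Equiv.Perm (Fin n)),
      (∀ x, Set.InjOn (fun w => ρ w x) (T : Set (FreeGroup (Fin m)))) →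
      ∃ q : Matrix (Fin n) (Fin n) ℂ, ∑ y, nsq ((1 - q).mulVec (Pi.single y 1)) ≤ δ * n ∧
        (∀ ξ, nsq (q.mulVec ξ) ≤ nsq ξ) ∧
        ∀ ζ, nsq ((permOp (fun i => ρ (FreeGroup.of i)) a).mulVec
          ((Matrix.kronecker q (1 : Matrix (Fin N) (Fin N) ℂ)).mulVec ζ)) ≤ c ^ 2 * nsq ζ := by
  have hc0 : 0 < c := by linarith
  have hr : 16 / c ^ 4 < 1 := by
    rw [div_lt_one (by positivity)]
    have : (2 : ℝ) ^ 4 < c ^ 4 := by gcongr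
    linarith
  obtain ⟨Q, hQ⟩ := exists_pow_lt_of_lt_one (show 0 < δ / (N ^ 2 + 1) by positivity) hr
  have hr0 : 0 ≤ 16 / c ^ 4 := by positivity
  have hQ' : (N : ℝ) ^ 2 * (16 / c ^ 4) ^ (Q + 1) ≤ δ := by
    have h1 : (16 / c ^ 4) ^ (Q + 1) ≤ δ / (N ^ 2 + 1) :=
      (pow_le_pow_of_le_one hr0 hr.le (Nat.le_succ Q)).trans hQ.le
    rw [le_div_iff₀ (by positivity)] at h1
    linarith [pow_nonneg hr0 (Q + 1)]
  obtain ⟨T, hT⟩ := exists_finset_nsq_pow_le ha ha' (Q + 1)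
  refine ⟨T, fun n ρ hρ => ?_⟩
  set V := permOp (fun i => ρ (FreeGroup.of i)) a
  have hV (ζ : Fin n × Fin N → ℂ) : nsq (V.mulVec ζ) ≤ c ^ 2 * (nsq ζ +
      nsq (((((c⁻¹ : ℝ) : ℂ) • V).conjTranspose * (((c⁻¹ : ℝ) : ℂ) • V)) ^ (Q + 1)
        |>.mulVec ζ)) := by
    have h1 := nsq_mulVec_le_add_pow (((c⁻¹ : ℝ) : ℂ) • V) (Nat.succ_pos Q) ζ
    rw [Matrix.smul_mulVec, nsq_smul, Complex.norm_real, Real.norm_of_nonneg (by positivity),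
      inv_pow, inv_mul_le_iff₀ (by positivity)] at h1
    exact h1
  obtain ⟨q, h1, h2, h3⟩ := exists_cut V _ (M := (16 / c ^ 4) ^ (Q + 1)) hV fun p => by
    rw [Matrix.conjTranspose_smul, Matrix.smul_mul, Matrix.mul_smul, smul_smul, smul_pow,
      Matrix.smul_mulVec, nsq_smul, div_pow, div_eq_inv_mul]
    refine (mul_le_mul_of_nonneg_left (hT n ρ hρ p) (by positivity)).trans_eq ?_
    congr 1
    simp only [Complex.star_def, Complex.conj_ofReal, norm_pow, norm_mul, Complex.norm_real,
      Real.norm_eq_abs, abs_of_pos (inv_pos.2 hc0)]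
    rw [← inv_pow, ← pow_mul, ← pow_two, ← pow_mul, ← inv_pow, ← pow_mul]
    congr 1
    ring
  refine ⟨q, h1.trans ?_, h2, h3⟩
  simp only [Fintype.card_fin]
  calc (N : ℝ) ^ 2 * n * (16 / c ^ 4) ^ (Q + 1) = (N : ℝ) ^ 2 * (16 / c ^ 4) ^ (Q + 1) * n := by ring
    _ ≤ δ * n := by gcongr

/-- The squared Hilbert-Schmidt norm of a matrix. -/
def hsSq {ι κ : Type*} [Fintype ι] [Fintype κ] (A : Matrix ι κ ℂ) : ℝ := ∑ y, nsq fun x => A x y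

theorem hsSq_eq {ι κ : Type*} [Fintype ι] [Fintype κ] [DecidableEq κ] (A : Matrix ι κ ℂ) :
    hsSq A = ∑ y, nsq (A.mulVec (Pi.single y 1)) := by
  simp only [hsSq, Matrix.mulVec_single_one]
  rfl

theorem norm_sum_mul_le {ι κ : Type*} [Fintype ι] [Fintype κ] (A B : Matrix ι κ ℂ) :
    ‖∑ k, ∑ l, A k l * B k l‖ ≤ √(hsSq A) * √(hsSq B) := by
  have h := norm_dotProduct_le (fun p : ι × κ => star (A p.1 p.2)) fun p => B p.1 p.2
  simpa [nsq, hsSq, dotProduct, Fintype.sum_prod_type, Finset.sum_comm (s := (Finset.univ : Finset ι))]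
    using h

theorem nsq_pushMat_mulVec {n : ℕ} (σ : Equiv.Perm (Fin n)) (ξ : Fin n → ℂ) :
    nsq ((pushMat σ).mulVec ξ) = nsq ξ := by
  simp only [nsq, pushMat_mulVec]
  exact Equiv.sum_comp σ.symm fun x => ‖ξ x‖ ^ 2

theorem hsSq_pushMat_mul {n : ℕ} (σ : Equiv.Perm (Fin n)) (A : Matrix (Fin n) (Fin n) ℂ) :
    hsSq (pushMat σ * A) = hsSq A := by
  simp only [hsSq_eq, ← Matrix.mulVec_mulVec, nsq_pushMat_mulVec]

theorem hsSq_le_of_contractive {n : ℕ} {A : Matrix (Fin n) (Fin n) ℂ}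
    (hA : ∀ ξ, nsq (A.mulVec ξ) ≤ nsq ξ) : hsSq A ≤ n := by
  rw [hsSq_eq]
  refine (Finset.sum_le_sum fun y _ => hA _).trans_eq ?_
  simp [nsq_single]

theorem norm_sum_pushMat_mul_sub_le {n : ℕ} (σ τ : Equiv.Perm (Fin n))
    {q r : Matrix (Fin n) (Fin n) ℂ} {δ : ℝ} (hδ : 0 ≤ δ)
    (hq : hsSq (1 - q) ≤ δ ^ 2 * n) (hr : hsSq (1 - r) ≤ δ ^ 2 * n)
    (hr' : ∀ ξ, nsq (r.mulVec ξ) ≤ nsq ξ) :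
    ‖∑ k, ∑ l, (pushMat σ * q) k l * (pushMat τ * r) k l -
      ∑ k, ∑ l, pushMat σ k l * pushMat τ k l‖ ≤ 2 * δ * n := by
  have h1 : ∑ k, ∑ l, (pushMat σ * q) k l * (pushMat τ * r) k l -
      ∑ k, ∑ l, pushMat σ k l * pushMat τ k l =
      -(∑ k, ∑ l, (pushMat σ * (1 - q)) k l * (pushMat τ * r) k l) -
      ∑ k, ∑ l, (pushMat σ * (1 : Matrix (Fin n) (Fin n) ℂ)) k l * (pushMat τ * (1 - r)) k l := by
    simp only [mul_sub, mul_one, Matrix.sub_apply, sub_mul, Finset.sum_sub_distrib]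
    ring
  have hn : √(δ ^ 2 * n) * √n = δ * n := by
    rw [Real.sqrt_mul (sq_nonneg _), Real.sqrt_sq hδ, mul_assoc,
      Real.mul_self_sqrt (Nat.cast_nonneg _)]
  have h2 := norm_sum_mul_le (pushMat σ * (1 - q)) (pushMat τ * r)
  have h3 := norm_sum_mul_le (pushMat σ * 1) (pushMat τ * (1 - r))
  rw [hsSq_pushMat_mul, hsSq_pushMat_mul] at h2 h3
  have h4 : √(hsSq (1 - q)) * √(hsSq r) ≤ √(δ ^ 2 * n) * √n := by
    gcongr; exact hsSq_le_of_contractive hr'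
  have h5 : √(hsSq (1 : Matrix (Fin n) (Fin n) ℂ)) * √(hsSq (1 - r)) ≤ √n * √(δ ^ 2 * n) := by
    gcongr; exact hsSq_le_of_contractive fun ξ => by rw [Matrix.one_mulVec]
  rw [mul_comm (√(n : ℝ))] at h5
  rw [hn] at h4 h5
  rw [h1]
  refine (norm_sub_le _ _).trans ?_
  rw [norm_neg]
  linarith

theorem sum_pushMat_mul {n : ℕ} (σ τ : Equiv.Perm (Fin n)) :
    ∑ k, ∑ l, pushMat σ k l * pushMat τ k l = ∑ x, if σ x = τ x then (1 : ℂ) else 0 := by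
  rw [Finset.sum_comm]
  refine Finset.sum_congr rfl fun x _ => ?_
  simp [pushMat, eq_comm]

/-- Two contractive columns of matrices admit almost biorthogonal matrix coefficients for which
the corresponding tensors have norm at most `c`, for any `c > 2`. -/
theorem exists_biorthogonal {m N N' : ℕ} {a : Fin m → Matrix (Fin N) (Fin N) ℂ}
    (ha : ColContractive a) (ha' : ColContractive fun i => (a i).conjTranspose)
    {b : Fin m → Matrix (Fin N') (Fin N') ℂ}
    (hb : ColContractive b) (hb' : ColContractive fun i => (b i).conjTranspose) {c ε : ℝ}
    (hc : 2 < c) (hε : 0 < ε) :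
    ∃ n : ℕ, 0 < n ∧ ∃ P R : Fin m → Matrix (Fin n) (Fin n) ℂ,
      (∀ i ξ, nsq ((P i).mulVec ξ) ≤ nsq ξ) ∧
      (∀ ζ, nsq ((∑ i, Matrix.kronecker (P i) (a i)).mulVec ζ) ≤ c ^ 2 * nsq ζ) ∧
      (∀ ζ, nsq ((∑ i, Matrix.kronecker (R i) (b i)).mulVec ζ) ≤ c ^ 2 * nsq ζ) ∧
      ∀ i j, ‖(n : ℂ)⁻¹ * ∑ k, ∑ l, P i k l * R j k l - if i = j then 1 else 0‖ ≤ ε := by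
  classical
  obtain ⟨T₁, h₁⟩ := exists_finset_cut ha ha' hc (show 0 < (ε / 2) ^ 2 by positivity)
  obtain ⟨T₂, h₂⟩ := exists_finset_cut hb hb' hc (show 0 < (ε / 2) ^ 2 by positivity)
  obtain ⟨n, hn, ρ, hρ⟩ := exists_perm_rep_injOn
    (T₁ ∪ T₂ ∪ Finset.univ.image (FreeGroup.of : Fin m → FreeGroup (Fin m)))
  obtain ⟨q, hq, hq1, hq2⟩ := h₁ n ρ fun x => (hρ x).mono (by
    intro w hw; simp [Finset.mem_coe.1 hw])
  obtain ⟨r, hr, hr1, hr2⟩ := h₂ n ρ fun x => (hρ x).mono (by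
    intro w hw; simp [Finset.mem_coe.1 hw])
  have hk {M : ℕ} (d : Fin m → Matrix (Fin M) (Fin M) ℂ) (p : Matrix (Fin n) (Fin n) ℂ)
      (ζ : Fin n × Fin M → ℂ) :
      (∑ i, Matrix.kronecker (pushMat (ρ (FreeGroup.of i)) * p) (d i)).mulVec ζ =
      (permOp (fun i => ρ (FreeGroup.of i)) d).mulVec
          ((Matrix.kronecker p (1 : Matrix (Fin M) (Fin M) ℂ)).mulVec ζ) := by
    rw [Matrix.mulVec_mulVec, permOp, Finset.sum_mul]
    congr 1
    refine Finset.sum_congr rfl fun i _ => ?_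
    have h := Matrix.mul_kronecker_mul (pushMat (ρ (FreeGroup.of i))) p (d i)
      (1 : Matrix (Fin M) (Fin M) ℂ)
    rwa [mul_one] at h
  refine ⟨n, hn, fun i => pushMat (ρ (FreeGroup.of i)) * q,
    fun i => pushMat (ρ (FreeGroup.of i)) * r, fun i ξ => ?_, fun ζ => ?_, fun ζ => ?_,
    fun i j => ?_⟩
  · rw [← Matrix.mulVec_mulVec, nsq_pushMat_mulVec]
    exact hq1 ξ
  · rw [hk]; exact hq2 ζ
  · rw [hk]; exact hr2 ζ
  · rw [← hsSq_eq] at hq hr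
    have h1 := norm_sum_pushMat_mul_sub_le (ρ (FreeGroup.of i)) (ρ (FreeGroup.of j))
      (by positivity) hq hr hr1
    have h2 : ∑ k, ∑ l, pushMat (ρ (FreeGroup.of i)) k l * pushMat (ρ (FreeGroup.of j)) k l =
        n * if i = j then 1 else 0 := by
      rw [sum_pushMat_mul]
      split_ifs with hij
      · simp [hij]
      · rw [mul_zero]
        refine Finset.sum_eq_zero fun x _ => if_neg fun h => hij ?_
        exact FreeGroup.of_injective (hρ x (by simp) (by simp) h)
    have hn' : (n : ℂ) ≠ 0 := by exact_mod_cast hn.ne'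
    rw [h2] at h1
    rw [← mul_le_mul_iff_right₀ (show 0 < ‖(n : ℂ)‖ by simpa using hn), ← norm_mul, mul_sub,
      mul_inv_cancel_left₀ hn', Complex.norm_natCast]
    linarith

theorem cstarNorm_eq_norm {C : Type*} [CStarAlgebra C] (a : C) : cstarNorm a = ‖a‖ :=
  CStarAlgebra.sqrt_toReal_spectralRadius_star_mul_self_eq_norm _

theorem cstarNorm_nonneg {C : Type*} [Ring C] [Algebra ℂ C] [Star C] (a : C) :
    0 ≤ cstarNorm a := Real.sqrt_nonneg _

theorem cstarNorm_algEquiv {C D : Type*} [Ring C] [Algebra ℂ C] [Star C] [Ring D] [Algebra ℂ D]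
    [Star D] (e : C ≃ₐ[ℂ] D) (he : ∀ x, e (star x) = star (e x)) (a : C) :
    cstarNorm (e a) = cstarNorm a := by
  rw [cstarNorm, cstarNorm, spectralRadius, spectralRadius, ← he, ← map_mul, AlgEquiv.spectrum_eq]

section Matrix

variable {n k : Type*} [Fintype n] [DecidableEq n] [Fintype k] [DecidableEq k]
  {B D : Type*} [CStarAlgebra B] [CStarAlgebra D]

/-- The C*-algebra of matrices over a C*-algebra. -/
@[reducible]
def matrixCStarAlgebra (n : Type*) [Fintype n] [DecidableEq n] (B : Type*) [CStarAlgebra B] :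
    CStarAlgebra (Matrix n n B) :=
  letI := CStarAlgebra.spectralOrder B
  letI := CStarAlgebra.spectralOrderedRing B
  inferInstanceAs (CStarAlgebra (CStarMatrix n n B))

theorem cstarNorm_matrix (M : Matrix n n B) : cstarNorm M =
    (letI := matrixCStarAlgebra n B; ‖M‖) :=
  letI := matrixCStarAlgebra n B
  cstarNorm_eq_norm M

theorem cstarNorm_mul_le (M M' : Matrix n n B) :
    cstarNorm (M * M') ≤ cstarNorm M * cstarNorm M' := by
  let := matrixCStarAlgebra n B
  rw [cstarNorm_matrix, cstarNorm_matrix, cstarNorm_matrix]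
  exact norm_mul_le M M'

theorem cstarNorm_sum_le {κ : Type*} (s : Finset κ) (M : κ → Matrix n n B) :
    cstarNorm (∑ i ∈ s, M i) ≤ ∑ i ∈ s, cstarNorm (M i) := by
  let := matrixCStarAlgebra n B
  simp only [cstarNorm_matrix]
  exact norm_sum_le s M

theorem cstarNorm_smul (c : ℂ) (M : Matrix n n B) : cstarNorm (c • M) = ‖c‖ * cstarNorm M := by
  let := matrixCStarAlgebra n B
  simp only [cstarNorm_matrix]
  exact norm_smul c M

theorem norm_entry_le_cstarNorm (M : Matrix n n B) (i j : n) : ‖M i j‖ ≤ cstarNorm M := by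
  let := CStarAlgebra.spectralOrder B
  let := CStarAlgebra.spectralOrderedRing B
  rw [cstarNorm_matrix]
  exact CStarMatrix.norm_entry_le_norm (M := (M : CStarMatrix n n B))

theorem cstarNorm_hom_le (φ : Matrix n n B →⋆ₙₐ[ℂ] Matrix k k D) (M : Matrix n n B) :
    cstarNorm (φ M) ≤ cstarNorm M := by
  let := matrixCStarAlgebra n B
  let := matrixCStarAlgebra k D
  rw [cstarNorm_matrix, cstarNorm_matrix]
  exact NonUnitalStarAlgHom.norm_apply_le φ M

theorem cstarNorm_hom_le_norm (φ : B →⋆ₙₐ[ℂ] Matrix k k D) (b : B) :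
    cstarNorm (φ b) ≤ ‖b‖ := by
  let := matrixCStarAlgebra k D
  rw [cstarNorm_matrix]
  exact NonUnitalStarAlgHom.norm_apply_le φ b

open scoped Matrix.Norms.L2Operator in
theorem cstarNorm_le_iff {M : Matrix n n ℂ} {c : ℝ} (hc : 0 ≤ c) :
    cstarNorm M ≤ c ↔ ∀ ζ, nsq (M.mulVec ζ) ≤ c ^ 2 * nsq ζ := by
  have h : cstarNorm M = ‖M‖ := cstarNorm_eq_norm M
  rw [h, Matrix.cstar_norm_def, ContinuousLinearMap.opNorm_le_iff hc]
  have h1 (ζ : n → ℂ) : nsq (M.mulVec ζ) ≤ c ^ 2 * nsq ζ ↔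
      ‖Matrix.toEuclideanCLM (n := n) (𝕜 := ℂ) M (WithLp.toLp 2 ζ)‖ ≤ c * ‖WithLp.toLp 2 ζ‖ := by
    rw [nsq_eq_norm_sq, nsq_eq_norm_sq, ← mul_pow, Matrix.toEuclideanCLM_toLp]
    exact pow_le_pow_iff_left₀ (norm_nonneg _) (by positivity) two_ne_zero
  simp only [h1]
  exact ⟨fun h ζ => h _, fun h ζ => h ζ.ofLp⟩

theorem cstarNorm_comp (M : Matrix n n (Matrix k k ℂ)) :
    cstarNorm (Matrix.comp n n k k ℂ M) = cstarNorm M :=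
  cstarNorm_algEquiv (Matrix.compAlgEquiv n k ℂ ℂ) (fun x => by ext; simp [Matrix.star_apply]) M

end Matrix

section Amplification

variable {n : Type*} [Fintype n] [DecidableEq n] {B D : Type*} [CStarAlgebra B] [CStarAlgebra D]

theorem cstarNorm_star (M : Matrix n n B) : cstarNorm (star M) = cstarNorm M := by
  let := matrixCStarAlgebra n B
  rw [cstarNorm_matrix, cstarNorm_matrix]
  exact norm_star M

theorem cstarNorm_star_mul_self (M : Matrix n n B) : cstarNorm (star M * M) = cstarNorm M ^ 2 := by
  let := matrixCStarAlgebra n B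
  rw [cstarNorm_matrix, cstarNorm_matrix, pow_two]
  exact CStarRing.norm_star_mul_self (x := M)

/-- The inclusion of scalar matrices. -/
def scalarMatrixHom (n : Type*) [Fintype n] (B : Type*) [CStarAlgebra B] :
    Matrix n n ℂ →⋆ₙₐ[ℂ] Matrix n n B where
  toFun c := c.map (algebraMap ℂ B)
  map_smul' c M := by ext; simp [Algebra.smul_def]
  map_zero' := by ext; simp
  map_add' M M' := by ext; simp
  map_mul' M M' := by ext; simp [Matrix.mul_apply]
  map_star' M := by ext i j; exact algebraMap_star_comm (M j i)

/-- The diagonal inclusion of an algebra in its matrices. -/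
def diagonalHom (n : Type*) [Fintype n] [DecidableEq n] (B : Type*) [CStarAlgebra B] :
    B →⋆ₙₐ[ℂ] Matrix n n B where
  toFun b := Matrix.diagonal fun _ => b
  map_smul' c b := by ext i j; by_cases h : i = j <;> simp [h]
  map_zero' := by simp
  map_add' b b' := by simp
  map_mul' b b' := by simp
  map_star' b := by
    ext i j
    rcases eq_or_ne i j with rfl | h
    · simp [Matrix.star_apply]
    · simp [Matrix.star_apply, h, h.symm]

/-- The inclusion of an algebra as a corner of its matrices. -/
def cornerHom {n : Type*} [Fintype n] [DecidableEq n] (j : n) (B : Type*) [CStarAlgebra B] :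
    B →⋆ₙₐ[ℂ] Matrix n n B where
  toFun b := Matrix.single j j b
  map_smul' c b := by simp [Matrix.smul_single]
  map_zero' := by simp
  map_add' b b' := by simp [Matrix.single_add]
  map_mul' b b' := by simp
  map_star' b := by rw [Matrix.star_eq_conjTranspose, Matrix.conjTranspose_single]

theorem cstarNorm_smul_elem_le (c : Matrix n n ℂ) (b : B) :
    cstarNorm (c.map fun z => z • b) ≤ cstarNorm c * ‖b‖ := by
  have h : (c.map fun z => z • b) = scalarMatrixHom n B c * diagonalHom n B b := by
    ext i j
    change c i j • b = (c.map (algebraMap ℂ B) * Matrix.diagonal fun _ => b : Matrix n n B) i j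
    rw [Matrix.mul_diagonal, Matrix.map_apply, Algebra.smul_def]
  rw [h]
  exact (cstarNorm_mul_le _ _).trans (mul_le_mul (cstarNorm_hom_le (B := ℂ) _ _)
    (cstarNorm_hom_le_norm _ _) (cstarNorm_nonneg _) (cstarNorm_nonneg _))

theorem nsq_star {ι : Type*} [Fintype ι] (f : ι → ℂ) : nsq (star f) = nsq f := by simp [nsq]

theorem cstarNorm_vecMulVec_le (f g : n → ℂ) :
    cstarNorm (Matrix.vecMulVec f (star g)) ≤ √(nsq f) * √(nsq g) := by
  refine (cstarNorm_le_iff (by positivity)).2 fun ζ => ?_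
  have h : (Matrix.vecMulVec f (star g)).mulVec ζ = (star g ⬝ᵥ ζ) • f := by
    rw [Matrix.vecMulVec_mulVec]; simp
  rw [h, nsq_smul, mul_pow, Real.sq_sqrt (nsq_nonneg f), Real.sq_sqrt (nsq_nonneg g)]
  have h1 := pow_le_pow_left₀ (norm_nonneg _) (norm_dotProduct_le g ζ) 2
  rw [mul_pow, Real.sq_sqrt (nsq_nonneg g), Real.sq_sqrt (nsq_nonneg ζ)] at h1
  nlinarith [nsq_nonneg f]

theorem norm_sum_smul_le (M : Matrix n n B) (η ζ : n → ℂ) :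
    ‖∑ i, ∑ j, (star (η i) * ζ j) • M i j‖ ≤ √(nsq η) * cstarNorm M * √(nsq ζ) := by
  rcases isEmpty_or_nonempty n with hn | ⟨⟨o⟩⟩
  · simp only [Finset.univ_eq_empty, Finset.sum_empty, norm_zero]
    exact mul_nonneg (mul_nonneg (Real.sqrt_nonneg _) (cstarNorm_nonneg _)) (Real.sqrt_nonneg _)
  let e : n → ℂ := Pi.single o 1
  have he : nsq e = 1 := by simp [e, nsq_single]
  have h1 := cstarNorm_vecMulVec_le e η
  have h2 := cstarNorm_vecMulVec_le ζ e
  rw [he, Real.sqrt_one, one_mul] at h1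
  rw [he, Real.sqrt_one, mul_one] at h2
  have h : (scalarMatrixHom n B (Matrix.vecMulVec e (star η)) * M *
      scalarMatrixHom n B (Matrix.vecMulVec ζ (star e))) o o =
      ∑ i, ∑ j, (star (η i) * ζ j) • M i j := by
    change (((Matrix.vecMulVec e (star η)).map (algebraMap ℂ B)) * M *
      ((Matrix.vecMulVec ζ (star e)).map (algebraMap ℂ B))) o o = _
    simp only [Matrix.mul_apply, Matrix.map_apply, Matrix.vecMulVec_apply, e, Pi.single_eq_same,
      Pi.star_apply, one_mul, star_one, mul_one, Finset.sum_mul]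
    rw [Finset.sum_comm]
    refine Finset.sum_congr rfl fun i _ => Finset.sum_congr rfl fun j _ => ?_
    rw [mul_assoc, ← Algebra.commutes, ← mul_assoc, ← map_mul, Algebra.smul_def]
  rw [← h]
  refine (norm_entry_le_cstarNorm _ _ _).trans ((cstarNorm_mul_le _ _).trans ?_)
  refine mul_le_mul ((cstarNorm_mul_le _ _).trans ?_)
    ((cstarNorm_hom_le (B := ℂ) _ _).trans h2) (cstarNorm_nonneg _)
    (mul_nonneg (Real.sqrt_nonneg _) (cstarNorm_nonneg _))
  exact mul_le_mul_of_nonneg_right ((cstarNorm_hom_le (B := ℂ) _ _).trans h1) (cstarNorm_nonneg _)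

/-- Bounded functionals are completely bounded. -/
theorem cstarNorm_map_functional_le {G : Submodule ℂ B} (f : ↥G →L[ℂ] ℂ) (x : Matrix n n ↥G) :
    cstarNorm (x.map fun e => f e) ≤ ‖f‖ * cstarNorm (x.map fun e => (e : B)) := by
  refine (cstarNorm_le_iff (mul_nonneg (norm_nonneg f) (cstarNorm_nonneg _))).2 fun ζ => ?_
  set η := (x.map fun e => f e).mulVec ζ with hη
  set X := cstarNorm (x.map fun e => (e : B)) with hX
  have h1 : (nsq η : ℂ) = f (∑ i, ∑ j, (star (η i) * ζ j) • x i j) := by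
    rw [← star_dotProduct_self]
    conv_lhs => rw [hη]
    simp only [map_sum, map_smul, dotProduct, Matrix.mulVec, Matrix.map_apply, smul_eq_mul,
      Finset.mul_sum]
    refine Finset.sum_congr rfl fun i _ => Finset.sum_congr rfl fun j _ => ?_
    rw [← hη, Pi.star_apply]
    ring
  have h2 : nsq η ≤ ‖f‖ * (√(nsq η) * X * √(nsq ζ)) := by
    calc nsq η = ‖(nsq η : ℂ)‖ := by
          rw [Complex.norm_real, Real.norm_of_nonneg (nsq_nonneg _)]
      _ ≤ ‖f‖ * ‖∑ i, ∑ j, (star (η i) * ζ j) • x i j‖ := by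
          rw [h1]; exact f.le_opNorm _
      _ ≤ _ := by
          refine mul_le_mul_of_nonneg_left ?_ (norm_nonneg f)
          have := norm_sum_smul_le (x.map fun e => (e : B)) η ζ
          rw [← Submodule.norm_coe]
          push_cast
          exact this
  have hXn : 0 ≤ X := cstarNorm_nonneg _
  have h3 : √(nsq η) ≤ ‖f‖ * X * √(nsq ζ) := by
    rcases (Real.sqrt_nonneg (nsq η)).eq_or_lt with h | h
    · rw [← h]; positivity
    · refine le_of_mul_le_mul_left ?_ h
      rw [Real.mul_self_sqrt (nsq_nonneg _)]
      linarith
  have h4 := pow_le_pow_left₀ (Real.sqrt_nonneg _) h3 2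
  rwa [Real.sq_sqrt (nsq_nonneg _), mul_pow, Real.sq_sqrt (nsq_nonneg _)] at h4

theorem cstarNorm_col_le (y : n → B) (o : n) :
    cstarNorm (Matrix.of fun i j => if j = o then y i else 0) ≤ √(∑ i, ‖y i‖ ^ 2) := by
  refine Real.le_sqrt_of_sq_le ?_
  rw [← cstarNorm_star_mul_self]
  have h : star (Matrix.of fun i j => if j = o then y i else 0 : Matrix n n B) *
      (Matrix.of fun i j => if j = o then y i else 0) =
      cornerHom o B (∑ i, star (y i) * y i) := by
    ext i j
    change _ = Matrix.single o o (∑ i, star (y i) * y i) i j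
    simp only [Matrix.mul_apply, Matrix.star_apply, Matrix.of_apply, Matrix.single_apply]
    simp only [eq_comm (a := o)]
    by_cases hi : i = o <;> by_cases hj : j = o <;> simp [hi, hj]
  rw [h]
  refine (cstarNorm_hom_le_norm _ _).trans ((norm_sum_le _ _).trans_eq ?_)
  exact Finset.sum_congr rfl fun i _ => by rw [CStarRing.norm_star_mul_self, pow_two]

theorem cstarNorm_row_le (y : n → B) (o : n) :
    cstarNorm (Matrix.of fun i j => if i = o then y j else 0) ≤ √(∑ i, ‖y i‖ ^ 2) := by
  rw [← cstarNorm_star]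
  have h := cstarNorm_col_le (fun i => star (y i)) o
  simp only [norm_star] at h
  convert h using 2
  ext i j
  simp [Matrix.star_apply, apply_ite star]

theorem bddAbove_cbNormSet (G : Submodule ℂ B) [FiniteDimensional ℂ ↥G] (H : Submodule ℂ D)
    (v : ↥G →ₗ[ℂ] ↥H) : BddAbove (cbNormSet G.subtype H.subtype v) := by
  let b := Module.finBasis ℂ ↥G
  let f (k) : ↥G →L[ℂ] ℂ := (b.coord k).toContinuousLinearMap
  refine ⟨∑ k, ‖f k‖ * ‖v (b k)‖, ?_⟩
  rintro _ ⟨n, x, hx, rfl⟩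
  have h : ((x.map fun e => v e).map fun e => H.subtype e) =
      ∑ k, (x.map fun e => f k e).map fun z => z • (v (b k) : D) := by
    ext i j
    rw [Matrix.sum_apply]
    simp only [Matrix.map_apply, Submodule.subtype_apply]
    have h1 := congrArg (fun e => (v e : D)) (b.sum_repr (x i j))
    simp only [map_sum, map_smul, Submodule.coe_sum, Submodule.coe_smul] at h1
    exact h1.symm
  rw [matNorm, h]
  refine (cstarNorm_sum_le _ _).trans (Finset.sum_le_sum fun k _ => ?_)
  refine (cstarNorm_smul_elem_le _ _).trans ?_
  refine mul_le_mul_of_nonneg_right ((cstarNorm_map_functional_le _ _).trans ?_) (norm_nonneg _)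
  exact mul_le_of_le_one_right (norm_nonneg (f k)) hx

theorem matNorm_smul {F : Type*} [AddCommGroup F] [Module ℂ F] (κ : F →ₗ[ℂ] B) {n : ℕ} (c : ℂ)
    (x : Matrix (Fin n) (Fin n) F) : matNorm κ (c • x) = ‖c‖ * matNorm κ x := by
  rw [matNorm, matNorm, ← cstarNorm_smul]
  congr 1
  ext; simp

theorem matNorm_inv_smul_le_one {F : Type*} [AddCommGroup F] [Module ℂ F] {κ : F →ₗ[ℂ] B} {n : ℕ}
    {x : Matrix (Fin n) (Fin n) F} {r : ℝ} (hr : 0 < r) (hx : matNorm κ x ≤ r) :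
    matNorm κ (((r⁻¹ : ℝ) : ℂ) • x) ≤ 1 := by
  rw [matNorm_smul, Complex.norm_real, Real.norm_of_nonneg (by positivity)]
  exact inv_mul_le_one_of_le₀ hx hr.le

theorem matNorm_map_le {F H : Type*} [AddCommGroup F] [Module ℂ F] [AddCommGroup H] [Module ℂ H]
    {ι : F →ₗ[ℂ] B} {κ : H →ₗ[ℂ] D} {v : F →ₗ[ℂ] H} (hv : BddAbove (cbNormSet ι κ v)) {n : ℕ}
    {x : Matrix (Fin n) (Fin n) F} {r : ℝ} (hr : 0 < r) (hx : matNorm ι x ≤ r) :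
    matNorm κ (x.map fun e => v e) ≤ cbNorm ι κ v * r := by
  have h : matNorm κ ((((r⁻¹ : ℝ) : ℂ) • x).map fun e => v e) ≤ cbNorm ι κ v :=
    le_csSup hv ⟨n, _, matNorm_inv_smul_le_one hr hx, rfl⟩
  have h2 : ((((r⁻¹ : ℝ) : ℂ) • x).map fun e => v e) = ((r⁻¹ : ℝ) : ℂ) • x.map fun e => v e := by
    ext; simp
  rw [h2, matNorm_smul, Complex.norm_real, Real.norm_of_nonneg (by positivity),
    inv_mul_le_iff₀ hr] at h
  linarith

theorem norm_sum_le_of_tbSet {E F : Type*} [AddCommGroup E] [Module ℂ E] [AddCommGroup F]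
    [Module ℂ F] {ι : E →ₗ[ℂ] B} {κ : F →ₗ[ℂ] D} {φ : E →ₗ[ℂ] F →ₗ[ℂ] ℂ}
    (h : BddAbove (tbSet ι κ φ)) {n : ℕ} (hn : 0 < n) {x : Matrix (Fin n) (Fin n) E}
    {y : Matrix (Fin n) (Fin n) F} {r s : ℝ} (hr : 0 < r) (hs : 0 < s)
    (hx : matNorm ι x ≤ r) (hy : matNorm κ y ≤ s) :
    ‖(n : ℂ)⁻¹ * ∑ i, ∑ j, φ (x i j) (y i j)‖ ≤ sSup (tbSet ι κ φ) * (r * s) := by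
  have h1 : ‖(n : ℂ)⁻¹ * ∑ i, ∑ j, φ ((((r⁻¹ : ℝ) : ℂ) • x) i j) ((((s⁻¹ : ℝ) : ℂ) • y) i j)‖ ≤
      sSup (tbSet ι κ φ) :=
    le_csSup h ⟨n, hn, _, _, matNorm_inv_smul_le_one hr hx, matNorm_inv_smul_le_one hs hy, rfl⟩
  have h2 : (n : ℂ)⁻¹ * ∑ i, ∑ j, φ ((((r⁻¹ : ℝ) : ℂ) • x) i j) ((((s⁻¹ : ℝ) : ℂ) • y) i j) =
      (((r * s)⁻¹ : ℝ) : ℂ) * ((n : ℂ)⁻¹ * ∑ i, ∑ j, φ (x i j) (y i j)) := by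
    simp only [Matrix.smul_apply, map_smul, LinearMap.smul_apply, smul_eq_mul, ← Finset.mul_sum]
    push_cast
    rw [mul_inv]
    ring
  rw [h2, norm_mul, Complex.norm_real, Real.norm_of_nonneg (by positivity),
    inv_mul_le_iff₀ (by positivity)] at h1
  linarith

end Amplification

theorem cbNorm_nonneg {A B : Type*} [Ring A] [Algebra ℂ A] [StarRing A]
    [Ring B] [Algebra ℂ B] [StarRing B]
    {E F : Type*} [AddCommGroup E] [Module ℂ E] [AddCommGroup F] [Module ℂ F]
    (ι : E →ₗ[ℂ] A) (κ : F →ₗ[ℂ] B) (v : E →ₗ[ℂ] F) : 0 ≤ cbNorm ι κ v := by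
  refine Real.sSup_nonneg ?_
  rintro _ ⟨n, x, -, rfl⟩
  exact cstarNorm_nonneg _

section Exact

variable {B : Type*} [CStarAlgebra B]

theorem exists_cbNorm_mul_lt {G : Submodule ℂ B} [FiniteDimensional ℂ ↥G] {d : ℝ}
    (hd : dSKfin G < d) :
    ∃ (N : ℕ) (Fm : Submodule ℂ (Matrix (Fin N) (Fin N) ℂ)) (v : ↥G ≃ₗ[ℂ] ↥Fm),
      cbNorm G.subtype Fm.subtype v.toLinearMap *
        cbNorm Fm.subtype G.subtype v.symm.toLinearMap < d := by
  have hne : {c | ∃ (N : ℕ) (Fm : Submodule ℂ (Matrix (Fin N) (Fin N) ℂ)) (v : ↥G ≃ₗ[ℂ] ↥Fm),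
      c = cbNorm G.subtype Fm.subtype v.toLinearMap *
        cbNorm Fm.subtype G.subtype v.symm.toLinearMap}.Nonempty := by
    let f : ↥G →ₗ[ℂ] Matrix (Fin (Module.finrank ℂ ↥G)) (Fin (Module.finrank ℂ ↥G)) ℂ :=
      (Matrix.diagonalLinearMap _ ℂ ℂ).comp (Module.finBasis ℂ ↥G).equivFun.toLinearMap
    have hf : Function.Injective f :=
      Matrix.diagonal_injective.comp (Module.finBasis ℂ ↥G).equivFun.injective
    exact ⟨_, _, _, LinearEquiv.ofInjective f hf, rfl⟩
  obtain ⟨_, ⟨N, Fm, v, rfl⟩, h⟩ := exists_lt_of_csInf_lt hne hd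
  exact ⟨N, Fm, v, h⟩

theorem sum_nsq_le_of_col {m N : ℕ} {w : Fin m → Matrix (Fin N) (Fin N) ℂ} {o : Fin m} {r : ℝ}
    (hr : 0 ≤ r) (h : cstarNorm (Matrix.of fun i j => if j = o then w i else 0) ≤ r)
    (ξ : Fin N → ℂ) : ∑ i, nsq ((w i).mulVec ξ) ≤ r ^ 2 * nsq ξ := by
  rw [← cstarNorm_comp, cstarNorm_le_iff hr] at h
  have h1 := h fun p => if p.1 = o then ξ p.2 else 0
  have h2 (p : Fin m × Fin N) : (Matrix.comp (Fin m) (Fin m) (Fin N) (Fin N) ℂ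
      (Matrix.of fun i j => if j = o then w i else 0)).mulVec
      (fun p => if p.1 = o then ξ p.2 else 0) p = (w p.1).mulVec ξ p.2 := by
    simp [Matrix.mulVec, dotProduct, Fintype.sum_prod_type]
  simp only [nsq, h2, Fintype.sum_prod_type] at h1
  have h3 : ∑ x, ∑ z, ‖if x = o then ξ z else 0‖ ^ 2 = ∑ z, ‖ξ z‖ ^ 2 := by
    rw [Finset.sum_eq_single_of_mem o (Finset.mem_univ _) fun b _ hb => by simp [hb]]
    simp
  rwa [h3] at h1

theorem colContractive_smul {m N : ℕ} {w : Fin m → Matrix (Fin N) (Fin N) ℂ} {r : ℝ} (hr : 0 < r)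
    (h : ∀ ξ, ∑ i, nsq ((w i).mulVec ξ) ≤ r ^ 2 * nsq ξ) :
    ColContractive fun i => ((r⁻¹ : ℝ) : ℂ) • w i := by
  intro ξ
  simp only [Matrix.smul_mulVec, nsq_smul, ← Finset.mul_sum]
  rw [Complex.norm_real, Real.norm_of_nonneg (by positivity), inv_pow,
    inv_mul_le_iff₀ (by positivity)]
  exact h ξ

open scoped Matrix.Norms.L2Operator in
theorem exists_matrix_model {m : ℕ} {G : Submodule ℂ B} [FiniteDimensional ℂ ↥G] {d r : ℝ}
    (hd : dSKfin G < d) (hr : 0 < r) (y : Fin m → ↥G) (hy : √(∑ i, ‖y i‖ ^ 2) ≤ r) :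
    ∃ (N : ℕ) (b : Fin m → Matrix (Fin N) (Fin N) ℂ), ColContractive b ∧
      (ColContractive fun i => (b i).conjTranspose) ∧
      ∀ (n : ℕ) (R : Fin m → Matrix (Fin n) (Fin n) ℂ) (c : ℝ), 0 < c →
        (∀ ζ, nsq ((∑ i, Matrix.kronecker (R i) (b i)).mulVec ζ) ≤ c ^ 2 * nsq ζ) →
        cstarNorm (Matrix.of fun k l => ∑ i, R i k l • (y i : B)) ≤ d * (r * c) := by
  obtain ⟨N, Fm, v, hv⟩ := exists_cbNorm_mul_lt hd
  set α₀ := cbNorm G.subtype Fm.subtype v.toLinearMap with hα₀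
  set β := cbNorm Fm.subtype G.subtype v.symm.toLinearMap with hβ
  have hα₀n : 0 ≤ α₀ := cbNorm_nonneg _ _ _
  have hβn : 0 ≤ β := cbNorm_nonneg _ _ _
  have : FiniteDimensional ℂ ↥Fm := v.finiteDimensional
  have hbv := bddAbove_cbNormSet G Fm v.toLinearMap
  have hbv' := bddAbove_cbNormSet Fm G v.symm.toLinearMap
  obtain ⟨α, hα, hαβ⟩ : ∃ α, α₀ < α ∧ β * α ≤ d := by
    have h1 : 0 < (d - α₀ * β) / (β + 1) := div_pos (by linarith) (by linarith)
    refine ⟨α₀ + (d - α₀ * β) / (β + 1), by linarith, ?_⟩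
    have h2 : (d - α₀ * β) / (β + 1) * (β + 1) = d - α₀ * β := div_mul_cancel₀ _ (by linarith)
    nlinarith
  have hαp : 0 < α := hα₀n.trans_lt hα
  let w (i : Fin m) : Matrix (Fin N) (Fin N) ℂ := v (y i)
  have hcol (o : Fin m) : cstarNorm (Matrix.of fun i j => if j = o then w i else 0) ≤ α * r := by
    have h1 : matNorm G.subtype (Matrix.of fun i j => if j = o then y i else 0) ≤ r := by
      refine le_trans (le_of_eq ?_) ((cstarNorm_col_le (fun i => (y i : B)) o).trans hy)
      rw [matNorm]
      congr 1
      ext i j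
      by_cases h : j = o <;> simp [h]
    have h2 := matNorm_map_le hbv hr h1
    refine le_trans (le_of_eq ?_) (h2.trans (mul_le_mul_of_nonneg_right hα.le hr.le))
    rw [matNorm]
    congr 1
    ext1 i j
    by_cases h : j = o <;> simp [h, w]
  have hrow (o : Fin m) : cstarNorm (Matrix.of fun i j => if j = o then (w i).conjTranspose else 0)
      ≤ α * r := by
    have h1 : matNorm G.subtype (Matrix.of fun i j => if i = o then y j else 0) ≤ r := by
      refine le_trans (le_of_eq ?_) ((cstarNorm_row_le (fun i => (y i : B)) o).trans hy)
      rw [matNorm]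
      congr 1
      ext i j
      by_cases h : i = o <;> simp [h]
    have h2 := matNorm_map_le hbv hr h1
    refine le_trans (le_of_eq ?_) (h2.trans (mul_le_mul_of_nonneg_right hα.le hr.le))
    rw [matNorm, ← cstarNorm_star]
    congr 1
    ext1 i j
    by_cases h : i = o <;> simp [h, w, Matrix.star_apply, Matrix.star_eq_conjTranspose]
  have hαr : 0 < α * r := mul_pos hαp hr
  refine ⟨N, fun i => (((α * r)⁻¹ : ℝ) : ℂ) • w i, ?_, ?_, ?_⟩
  · rcases isEmpty_or_nonempty (Fin m) with hm | ⟨⟨o⟩⟩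
    · intro ξ; simpa using nsq_nonneg ξ
    · exact colContractive_smul hαr (sum_nsq_le_of_col hαr.le (hcol o))
  · rcases isEmpty_or_nonempty (Fin m) with hm | ⟨⟨o⟩⟩
    · intro ξ; simpa using nsq_nonneg ξ
    · have := colContractive_smul hαr (sum_nsq_le_of_col hαr.le (hrow o))
      simpa [Matrix.conjTranspose_smul] using this
  · intro n R c hc hR
    let Y : Matrix (Fin n) (Fin n) ↥G := Matrix.of fun k l => ∑ i, R i k l • y i
    have h1 : matNorm Fm.subtype (Y.map fun e => v.toLinearMap e) ≤ α * r * c := by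
      rw [← cstarNorm_le_iff hc.le] at hR
      rw [matNorm, ← cstarNorm_comp]
      have h2 : Matrix.comp (Fin n) (Fin n) (Fin N) (Fin N) ℂ
          ((Y.map fun e => v.toLinearMap e).map fun e => Fm.subtype e) =
          ((α * r : ℝ) : ℂ) • ∑ i, Matrix.kronecker (R i) ((((α * r)⁻¹ : ℝ) : ℂ) • w i) := by
        ext ⟨k, s⟩ ⟨l, t⟩
        simp only [Matrix.comp_apply, Matrix.map_apply, Y, Matrix.of_apply, map_sum, map_smul,
          Matrix.smul_apply, Matrix.sum_apply, Matrix.kronecker, Matrix.kroneckerMap_apply,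
          smul_eq_mul, Finset.mul_sum, Submodule.subtype_apply, w, LinearEquiv.coe_coe,
          Submodule.coe_sum, Submodule.coe_smul]
        refine Finset.sum_congr rfl fun i _ => ?_
        have : ((α * r : ℝ) : ℂ) ≠ 0 := Complex.ofReal_ne_zero.2 hαr.ne'
        rw [Complex.ofReal_inv]
        field_simp
      rw [h2, cstarNorm_smul, Complex.norm_real, Real.norm_of_nonneg hαr.le]
      exact mul_le_mul_of_nonneg_left hR hαr.le
    have h3 := matNorm_map_le hbv' (mul_pos hαr hc) h1
    calc cstarNorm (Matrix.of fun k l => ∑ i, R i k l • (y i : B)) = matNorm G.subtype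
          ((Y.map fun e => v.toLinearMap e).map fun e => v.symm.toLinearMap e) := by
          rw [matNorm]
          congr 1
          ext k l
          simp [Y]
      _ ≤ β * (α * r * c) := h3
      _ = β * α * (r * c) := by ring
      _ ≤ d * (r * c) := mul_le_mul_of_nonneg_right hαβ (mul_pos hr hc).le

end Exact

section Commutative

variable {A : Type*} [CommCStarAlgebra A]

theorem mem_spectrum_matrix_iff {n R : Type*} [Fintype n] [DecidableEq n] [CommRing R]
    [Algebra ℂ R] (M : Matrix n n R) (z : ℂ) :
    z ∈ spectrum ℂ M ↔ ¬IsUnit (algebraMap ℂ (Matrix n n R) z - M).det := by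
  rw [spectrum.mem_iff, Matrix.isUnit_iff_isUnit_det]

theorem norm_le_of_mem_spectrum {n : Type*} [Fintype n] [DecidableEq n] {M : Matrix n n ℂ} {z : ℂ}
    (hz : z ∈ spectrum ℂ (star M * M)) : ‖z‖ ≤ cstarNorm M ^ 2 := by
  rw [← cstarNorm_star_mul_self, cstarNorm_matrix]
  let := matrixCStarAlgebra n ℂ
  have h := (IsSelfAdjoint.star_mul_self M).spectralRadius_eq_nnnorm
  have h1 : (‖z‖₊ : ENNReal) ≤ spectralRadius ℂ (star M * M) :=
    le_iSup₂ (f := fun k _ => (‖k‖₊ : ENNReal)) z hz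
  rw [h] at h1
  exact_mod_cast h1

/-- The norm of a matrix over a commutative C*-algebra is computed by the characters. -/
theorem cstarNorm_le_of_characters {n : Type*} [Fintype n] [DecidableEq n] {x : Matrix n n A}
    {r : ℝ} (hr : 0 ≤ r)
    (h : ∀ φ : WeakDual.characterSpace ℂ A, cstarNorm (x.map fun a => φ a) ≤ r) :
    cstarNorm x ≤ r := by
  have h1 : spectralRadius ℂ (star x * x) ≤ ENNReal.ofReal (r ^ 2) := by
    refine iSup₂_le fun z hz => ?_
    obtain ⟨φ, hφ⟩ := WeakDual.CharacterSpace.exists_apply_eq_zero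
      ((mem_spectrum_matrix_iff _ _).1 hz)
    have hz' : z ∈ spectrum ℂ (star (x.map fun a => φ a) * (x.map fun a => φ a)) := by
      rw [mem_spectrum_matrix_iff]
      have h2 : algebraMap ℂ (Matrix n n ℂ) z - star (x.map fun a => φ a) * (x.map fun a => φ a) =
          (WeakDual.CharacterSpace.toAlgHom φ).mapMatrix
            (algebraMap ℂ (Matrix n n A) z - star x * x) := by
        rw [map_sub, AlgHom.commutes, map_mul]
        congr 2
        ext i j
        exact (map_star φ (x j i)).symm
      rw [h2, ← AlgHom.map_det]
      have h3 : (WeakDual.CharacterSpace.toAlgHom φ)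
          (algebraMap ℂ (Matrix n n A) z - star x * x).det = 0 := hφ
      rw [h3]
      exact not_isUnit_zero
    have h4 := (norm_le_of_mem_spectrum hz').trans
      (pow_le_pow_left₀ (cstarNorm_nonneg _) (h φ) 2)
    rw [← enorm_eq_nnnorm, ← ofReal_norm z]
    exact ENNReal.ofReal_le_ofReal h4
  rw [cstarNorm]
  refine (Real.sqrt_le_left hr).2 ?_
  exact ENNReal.toReal_le_of_le_ofReal (by positivity) h1

/-- A finite net in the unit ball of `ℂ^m` turns Kronecker products with diagonal matrices
into bounds for scalar combinations. -/
theorem exists_diagonal_model (m : ℕ) {η : ℝ} (hη : 0 < η) :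
    ∃ (N : ℕ) (a : Fin m → Matrix (Fin N) (Fin N) ℂ), ColContractive a ∧
      (ColContractive fun i => (a i).conjTranspose) ∧
      ∀ (n : ℕ) (P : Fin m → Matrix (Fin n) (Fin n) ℂ) (c : ℝ), 0 ≤ c →
        (∀ i ξ, nsq ((P i).mulVec ξ) ≤ nsq ξ) →
        (∀ ζ, nsq ((∑ i, Matrix.kronecker (P i) (a i)).mulVec ζ) ≤ c ^ 2 * nsq ζ) →
        ∀ t : Fin m → ℂ, nsq t ≤ 1 → cstarNorm (∑ i, t i • P i) ≤ c + m * η := by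
  have hcpt : IsCompact {t : Fin m → ℂ | nsq t ≤ 1} := by
    refine Metric.isCompact_of_isClosed_isBounded ?_ ?_
    · refine isClosed_le ?_ continuous_const
      unfold nsq
      fun_prop
    · refine (Metric.isBounded_closedBall (x := (0 : Fin m → ℂ)) (r := 1)).subset fun t ht => ?_
      rw [mem_closedBall_zero_iff, pi_norm_le_iff_of_nonneg zero_le_one]
      intro i
      have h : ‖t i‖ ^ 2 ≤ 1 := (Finset.single_le_sum (f := fun i => ‖t i‖ ^ 2)
        (fun i _ => by positivity) (Finset.mem_univ i)).trans ht
      exact (sq_le_one_iff₀ (norm_nonneg _)).1 h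
  obtain ⟨s, hs, hfin, hcov⟩ := hcpt.finite_cover_balls hη
  obtain ⟨N, τ, -, rfl⟩ := hfin.fin_param
  have hτ (k : Fin N) : nsq (τ k) ≤ 1 := hs ⟨k, rfl⟩
  have hdiag (σ : Fin N → Fin m → ℂ) (hσ : ∀ k, nsq (σ k) ≤ 1) :
      ColContractive fun i => Matrix.diagonal fun k => σ k i := by
    intro ξ
    simp only [nsq, Matrix.mulVec_diagonal, norm_mul, mul_pow]
    rw [Finset.sum_comm]
    simp only [← Finset.sum_mul]
    exact Finset.sum_le_sum fun k _ => mul_le_of_le_one_left (by positivity) (hσ k)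
  refine ⟨N, fun i => Matrix.diagonal fun k => τ k i, hdiag τ hτ, ?_, ?_⟩
  · simp only [Matrix.diagonal_conjTranspose]
    exact hdiag (fun k => star (τ k)) fun k => by rw [nsq_star]; exact hτ k
  · intro n P c hc hP hK t ht
    have hnet (k : Fin N) : cstarNorm (∑ i, τ k i • P i) ≤ c := by
      refine (cstarNorm_le_iff hc).2 fun ξ => ?_
      have h1 := hK fun p => if p.2 = k then ξ p.1 else 0
      have h2 (p : Fin n × Fin N) : (∑ i, Matrix.kronecker (P i)
          (Matrix.diagonal fun k => τ k i)).mulVec (fun p => if p.2 = k then ξ p.1 else 0) p =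
          if p.2 = k then (∑ i, τ k i • P i).mulVec ξ p.1 else 0 := by
        rw [Matrix.sum_mulVec, Matrix.sum_mulVec, Finset.sum_apply, Finset.sum_apply]
        rcases eq_or_ne p.2 k with h | h
        · simp [Matrix.mulVec, dotProduct, Fintype.sum_prod_type, Matrix.kroneckerMap_apply,
            Matrix.diagonal_apply, h, mul_comm, mul_left_comm]
        · simp [Matrix.mulVec, dotProduct, Fintype.sum_prod_type, Matrix.kroneckerMap_apply,
            Matrix.diagonal_apply, h]
      have h3 (f : Fin n → ℂ) : nsq (fun p : Fin n × Fin N => if p.2 = k then f p.1 else 0) =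
          nsq f := by
        rw [nsq_prod, Finset.sum_eq_single_of_mem k (Finset.mem_univ _)
          fun b _ hb => by simp [hb, nsq]]
        simp
      rw [funext h2, h3 ((∑ i, τ k i • P i).mulVec ξ), h3] at h1
      exact h1
    obtain ⟨_, ⟨k, rfl⟩, hk⟩ := Set.mem_iUnion₂.1 (hcov ht)
    have h1 : ∑ i, t i • P i = ∑ i, τ k i • P i + ∑ i, (t i - τ k i) • P i := by
      rw [← Finset.sum_add_distrib]
      exact Finset.sum_congr rfl fun i _ => by rw [← add_smul]; simp
    have h2 : cstarNorm (∑ i, (t i - τ k i) • P i) ≤ m * η := by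
      refine (cstarNorm_sum_le _ _).trans ?_
      have : ∀ i ∈ Finset.univ, cstarNorm ((t i - τ k i) • P i) ≤ η := by
        intro i _
        rw [cstarNorm_smul]
        have h3 : ‖t i - τ k i‖ ≤ η := by
          have := norm_le_pi_norm (t - τ k) i
          rw [mem_ball_iff_norm] at hk
          exact this.trans hk.le
        have h4 : cstarNorm (P i) ≤ 1 :=
          (cstarNorm_le_iff zero_le_one).2 fun ξ => by simpa using hP i ξ
        nlinarith [norm_nonneg (t i - τ k i)]
      simpa using Finset.sum_le_card_nsmul _ _ _ this
    rw [h1]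
    have h3 := cstarNorm_sum_le Finset.univ ![∑ i, τ k i • P i, ∑ i, (t i - τ k i) • P i]
    simp only [Fin.sum_univ_two, Matrix.cons_val_zero, Matrix.cons_val_one] at h3
    linarith [hnet k]

theorem matNorm_le_of_characters {m n : ℕ} {E : Submodule ℂ A} {x : Fin m → ↥E} {W r : ℝ}
    (hW : 0 < W) (hr : 0 ≤ r)
    (hx : ∀ φ : WeakDual.characterSpace ℂ A, ∑ i, ‖φ (x i)‖ ^ 2 ≤ W ^ 2)
    {P : Fin m → Matrix (Fin n) (Fin n) ℂ}
    (hP : ∀ t : Fin m → ℂ, nsq t ≤ 1 → cstarNorm (∑ i, t i • P i) ≤ r) :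
    matNorm E.subtype (Matrix.of fun k l => ∑ i, P i k l • x i) ≤ W * r := by
  refine cstarNorm_le_of_characters (mul_nonneg hW.le hr) fun φ => ?_
  have h1 : (((Matrix.of fun k l => ∑ i, P i k l • x i).map fun e => E.subtype e).map
      fun a => φ a) = (W : ℂ) • ∑ i, ((W⁻¹ : ℝ) : ℂ) • φ (x i) • P i := by
    have : (W : ℂ) ≠ 0 := Complex.ofReal_ne_zero.2 hW.ne'
    rw [← Finset.smul_sum, smul_smul, Complex.ofReal_inv, mul_inv_cancel₀ this, one_smul]
    ext k l
    simp [Matrix.sum_apply, mul_comm]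
  rw [h1, cstarNorm_smul, Complex.norm_real, Real.norm_of_nonneg hW.le]
  refine mul_le_mul_of_nonneg_left ?_ hW.le
  have h2 := hP (fun i => ((W⁻¹ : ℝ) : ℂ) * φ (x i)) ?_
  · simpa only [smul_smul] using h2
  · simp only [nsq, norm_mul, mul_pow, ← Finset.mul_sum]
    rw [Complex.norm_real, Real.norm_of_nonneg (by positivity), inv_pow,
      inv_mul_le_iff₀ (by positivity), mul_one]
    exact hx φ

end Commutative

theorem sum_comm_four {ι κ : Type*} [Fintype ι] [Fintype κ] (g : κ → κ → ι → ι → ℂ) :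
    ∑ k, ∑ l, ∑ j, ∑ i, g k l j i = ∑ i, ∑ j, ∑ k, ∑ l, g k l j i := by
  have h (f : κ → κ → ι → ℂ) : ∑ k, ∑ l, ∑ i, f k l i = ∑ i, ∑ k, ∑ l, f k l i :=
    (Finset.sum_congr rfl fun k _ => Finset.sum_comm).trans Finset.sum_comm
  rw [h, Finset.sum_congr rfl fun j _ => h fun k l i => g k l j i]
  exact Finset.sum_comm

section Pairing

variable {A B : Type*} [CommCStarAlgebra A] [CStarAlgebra B] {E : Submodule ℂ A}
  {F : Submodule ℂ B}

theorem norm_sum_pairing_le_add {u : ↥E →ₗ[ℂ] (↥F →L[ℂ] ℂ)}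
    (hu : BddAbove (tbSet E.subtype F.subtype (dualPairing u)))
    (hFex : IsExactSubspace F) {m : ℕ} (x : Fin m → ↥E) (y : Fin m → ↥F) {W d r s : ℝ}
    (hW : 0 < W) (hx : ∀ φ : WeakDual.characterSpace ℂ A, ∑ i, ‖φ (x i)‖ ^ 2 ≤ W ^ 2)
    (hr : 0 < r) (hy : √(∑ i, ‖y i‖ ^ 2) ≤ r) (hd : dSK F < d) (hd₀ : 0 < d) (hs : 0 < s) :
    ‖∑ i, u (x i) (y i)‖ ≤ sSup (tbSet E.subtype F.subtype (dualPairing u)) *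
      (W * (2 + s + m * s) * (d * (r * (2 + s)))) + s * ∑ i, ∑ j, ‖u (x i) (y j)‖ := by
  let G : Submodule ℂ B := Submodule.span ℂ (Set.range fun i => (y i : B))
  have hGF : G ≤ F := Submodule.span_le.2 (by rintro _ ⟨i, rfl⟩; exact (y i).2)
  have : FiniteDimensional ℂ ↥G := FiniteDimensional.span_of_finite ℂ (Set.finite_range _)
  have hG : dSKfin G < d := (le_csSup hFex ⟨G, hGF, this, rfl⟩).trans_lt hd
  obtain ⟨N', b, hb, hb', hbR⟩ := exists_matrix_model hG hr
    (fun i => (⟨y i, Submodule.subset_span ⟨i, rfl⟩⟩ : ↥G)) hy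
  obtain ⟨N, a, ha, ha', haP⟩ := exists_diagonal_model m hs
  obtain ⟨n, hn, P, R, hP, hPa, hRb, hPR⟩ :=
    exists_biorthogonal ha ha' hb hb' (show (2 : ℝ) < 2 + s by linarith) hs
  have hX := matNorm_le_of_characters hW (r := 2 + s + m * s) (by positivity) hx
    (haP n P (2 + s) (by linarith) hP hPa)
  have hY : matNorm F.subtype (Matrix.of fun k l => ∑ i, R i k l • y i) ≤ d * (r * (2 + s)) := by
    refine le_trans (le_of_eq ?_) (hbR n R (2 + s) (by linarith) hRb)
    rw [matNorm]
    congr 1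
    ext k l
    simp
  have key := norm_sum_le_of_tbSet hu hn (by positivity) (by positivity) hX hY
  set Δ : Fin m → Fin m → ℂ := fun i j => (n : ℂ)⁻¹ * ∑ k, ∑ l, P i k l * R j k l with hΔ
  have h1 : (n : ℂ)⁻¹ * ∑ k, ∑ l, dualPairing u ((Matrix.of fun k l => ∑ i, P i k l • x i) k l)
      ((Matrix.of fun k l => ∑ i, R i k l • y i) k l) = ∑ i, ∑ j, Δ i j * u (x i) (y j) := by
    change _ = ∑ i, ∑ j, Δ i j * dualPairing u (x i) (y j)
    simp only [Matrix.of_apply, map_sum, map_smul, LinearMap.sum_apply, LinearMap.smul_apply,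
      smul_eq_mul, hΔ, Finset.mul_sum, Finset.sum_mul]
    rw [sum_comm_four]
    refine Finset.sum_congr rfl fun i _ => Finset.sum_congr rfl fun j _ => ?_
    refine Finset.sum_congr rfl fun k _ => Finset.sum_congr rfl fun l _ => ?_
    ring
  rw [h1] at key
  have h2 : ∑ i, u (x i) (y i) = ∑ i, ∑ j, Δ i j * u (x i) (y j) -
      ∑ i, ∑ j, (Δ i j - if i = j then 1 else 0) * u (x i) (y j) := by
    simp [sub_mul, Finset.sum_sub_distrib]
  rw [h2]
  refine (norm_sub_le _ _).trans (add_le_add key ?_)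
  rw [Finset.mul_sum]
  refine (norm_sum_le _ _).trans (Finset.sum_le_sum fun i _ => ?_)
  rw [Finset.mul_sum]
  refine (norm_sum_le _ _).trans (Finset.sum_le_sum fun j _ => ?_)
  rw [norm_mul]
  exact mul_le_mul_of_nonneg_right (hPR i j) (norm_nonneg _)

theorem dSK_nonneg (F : Submodule ℂ B) : 0 ≤ dSK F := by
  refine Real.sSup_nonneg ?_
  rintro _ ⟨G, -, -, rfl⟩
  refine Real.sInf_nonneg ?_
  rintro _ ⟨N, Fm, v, rfl⟩
  exact mul_nonneg (cbNorm_nonneg _ _ _) (cbNorm_nonneg _ _ _)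

theorem norm_sum_pairing_le {u : ↥E →ₗ[ℂ] (↥F →L[ℂ] ℂ)}
    (hu : BddAbove (tbSet E.subtype F.subtype (dualPairing u)))
    (hFex : IsExactSubspace F) {m : ℕ} (x : Fin m → ↥E) (y : Fin m → ↥F) {W : ℝ}
    (hW : 0 ≤ W) (hx : ∀ φ : WeakDual.characterSpace ℂ A, ∑ i, ‖φ (x i)‖ ^ 2 ≤ W ^ 2) :
    ‖∑ i, u (x i) (y i)‖ ≤ 4 * dSK F * sSup (tbSet E.subtype F.subtype (dualPairing u)) *
      (W * √(∑ i, ‖y i‖ ^ 2)) := by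
  set T := sSup (tbSet E.subtype F.subtype (dualPairing u))
  set Y := √(∑ i, ‖y i‖ ^ 2)
  have hY : 0 ≤ Y := Real.sqrt_nonneg _
  have hd := dSK_nonneg F
  let f (s : ℝ) : ℝ := T * ((W + s) * (2 + s + m * s) * ((dSK F + s) * ((Y + s) * (2 + s)))) +
    s * ∑ i, ∑ j, ‖u (x i) (y j)‖
  have hf : Filter.Tendsto f (nhdsWithin 0 (Set.Ioi 0)) (nhds (f 0)) := by
    have : Continuous f := by fun_prop
    exact this.continuousAt.tendsto.mono_left nhdsWithin_le_nhds
  have h : ‖∑ i, u (x i) (y i)‖ ≤ f 0 := by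
    refine ge_of_tendsto hf ?_
    filter_upwards [self_mem_nhdsWithin] with s hs
    have hs : 0 < s := hs
    refine norm_sum_pairing_le_add hu hFex x y (by linarith) (fun φ => (hx φ).trans ?_)
      (by linarith) (by linarith) (by linarith) (by linarith) hs
    exact pow_le_pow_left₀ hW (by linarith) 2
  refine h.trans_eq ?_
  simp only [f]
  ring

theorem sSup_tbSet_nonneg (u : ↥E →ₗ[ℂ] (↥F →L[ℂ] ℂ)) :
    0 ≤ sSup (tbSet E.subtype F.subtype (dualPairing u)) := by
  refine Real.sSup_nonneg ?_
  rintro _ ⟨n, -, x, y, -, -, rfl⟩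
  exact norm_nonneg _

theorem exists_almost_norming {X : Type*} [NormedAddCommGroup X] [NormedSpace ℂ X]
    (f : X →L[ℂ] ℂ) {δ : ℝ} (hδ : 0 < δ) :
    ∃ (y : X) (t : ℝ), ‖y‖ ≤ ‖f‖ ∧ f y = t ∧ (1 - δ) * ‖f‖ ^ 2 ≤ t := by
  rcases (norm_nonneg f).eq_or_lt with h | h
  · exact ⟨0, 0, by simp, by simp, by simp [← h]⟩
  obtain ⟨z, hz, hfz⟩ := f.exists_lt_apply_of_lt_opNorm (r := (1 - δ) * ‖f‖) (by nlinarith)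
  obtain ⟨w, hw, hwz⟩ : ∃ w : ℂ, ‖w‖ ≤ 1 ∧ w * f z = ‖f z‖ := by
    rcases eq_or_ne (f z) 0 with h0 | h0
    · exact ⟨0, by simp, by simp [h0]⟩
    · have h1 : (‖f z‖ : ℂ) ≠ 0 := by simpa using h0
      refine ⟨star (f z) / ‖f z‖, by simp [h0], ?_⟩
      have h2 : star (f z) * f z = (‖f z‖ : ℂ) ^ 2 := Complex.conj_mul' _
      rw [div_mul_eq_mul_div, h2, pow_two, mul_div_assoc, div_self h1, mul_one]
  refine ⟨((‖f‖ : ℂ) * w) • z, ‖f‖ * ‖f z‖, ?_, ?_, by nlinarith⟩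
  · rw [norm_smul, norm_mul, Complex.norm_real, norm_norm, mul_assoc]
    exact mul_le_of_le_one_right h.le (mul_le_one₀ hw (norm_nonneg _) hz.le)
  · rw [map_smul, smul_eq_mul, mul_assoc, hwz]
    push_cast
    rfl

theorem sum_norm_sq_le_of_pairing {X : Type*} [NormedAddCommGroup X] [NormedSpace ℂ X] {m : ℕ}
    (f : Fin m → X →L[ℂ] ℂ) {K : ℝ} (hK : 0 ≤ K)
    (h : ∀ y : Fin m → X, ‖∑ i, f i (y i)‖ ≤ K * √(∑ i, ‖y i‖ ^ 2)) :
    ∑ i, ‖f i‖ ^ 2 ≤ K ^ 2 := by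
  set S := ∑ i, ‖f i‖ ^ 2 with hS
  have hS₀ : 0 ≤ S := Finset.sum_nonneg fun i _ => by positivity
  rcases hS₀.eq_or_lt with h0 | h0
  · rw [← h0]; positivity
  have h1 (δ : ℝ) (hδ : 0 < δ) : (1 - δ) * S ≤ K * √S := by
    choose y t hy hfy ht using fun i => exists_almost_norming (f i) hδ
    have h2 : ∑ i, f i (y i) = ((∑ i, t i : ℝ) : ℂ) := by
      rw [Complex.ofReal_sum]
      exact Finset.sum_congr rfl fun i _ => hfy i
    have h3 : (1 - δ) * S ≤ ∑ i, t i := by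
      rw [hS, Finset.mul_sum]
      exact Finset.sum_le_sum fun i _ => ht i
    have h4 := h y
    rw [h2, Complex.norm_real] at h4
    refine h3.trans ((Real.le_norm_self _).trans (h4.trans ?_))
    refine mul_le_mul_of_nonneg_left (Real.sqrt_le_sqrt ?_) hK
    exact Finset.sum_le_sum fun i _ => pow_le_pow_left₀ (norm_nonneg _) (hy i) 2
  have h2 : S ≤ K * √S := by
    have hf : Filter.Tendsto (fun δ => (1 - δ) * S) (nhdsWithin 0 (Set.Ioi 0))
        (nhds ((1 - 0) * S)) := by
      have : Continuous fun δ => (1 - δ) * S := by fun_prop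
      exact this.continuousAt.tendsto.mono_left nhdsWithin_le_nhds
    have := le_of_tendsto hf (Filter.eventually_of_mem self_mem_nhdsWithin h1)
    simpa using this
  have h3 : √S ≤ K := by
    refine le_of_mul_le_mul_right ?_ (Real.sqrt_pos.2 h0)
    rwa [Real.mul_self_sqrt hS₀]
  exact Real.sqrt_le_left hK |>.1 h3

end Pairing

/-- **2-summingness on commutative × exact** (Corollary 1.7 in Junge–Pisier).  Let `E` be
a closed subspace of a commutative unital C*-algebra `A`, and `F ⊆ B` an exact closed
subspace of a C*-algebra `B`.  Then every tracially bounded linear map `u : E → F*` is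
2-absolutely summing with `π₂(u) ≤ 4 d_SK(F) ‖u‖_tb`. -/
theorem commutative_exact_two_summing {A B : Type*}
    [CommCStarAlgebra A] [CStarAlgebra B]
    (E : Submodule ℂ A) (F : Submodule ℂ B)
    (hE : IsClosed (E : Set A)) (hF : IsClosed (F : Set B))
    (hFex : IsExactSubspace F)
    (u : ↥E →ₗ[ℂ] (↥F →L[ℂ] ℂ))
    (hu : BddAbove (tbSet E.subtype F.subtype (dualPairing u))) :
    Pi2Bound (X := ↥E) (Y := ↥F →L[ℂ] ℂ) u
      (4 * dSK F * sSup (tbSet E.subtype F.subtype (dualPairing u))) := by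
  intro m x
  set S := {r | ∃ ξ : ↥E →L[ℂ] ℂ, ‖ξ‖ ≤ 1 ∧ r = ∑ i, ‖ξ (x i)‖ ^ 2}
  have hS : BddAbove S := by
    refine ⟨∑ i, ‖x i‖ ^ 2, ?_⟩
    rintro _ ⟨ξ, hξ, rfl⟩
    refine Finset.sum_le_sum fun i _ => pow_le_pow_left₀ (norm_nonneg _) ?_ 2
    exact (ξ.le_opNorm _).trans (mul_le_of_le_one_left (norm_nonneg _) hξ)
  have hS₀ : 0 ≤ sSup S := by
    refine Real.sSup_nonneg ?_
    rintro _ ⟨ξ, -, rfl⟩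
    positivity
  have hx (φ : WeakDual.characterSpace ℂ A) : ∑ i, ‖φ (x i)‖ ^ 2 ≤ √(sSup S) ^ 2 := by
    rw [Real.sq_sqrt hS₀]
    refine le_csSup hS ⟨(WeakDual.CharacterSpace.toCLM φ).comp E.subtypeL, ?_, rfl⟩
    refine ContinuousLinearMap.opNorm_le_bound _ zero_le_one fun e => ?_
    rw [one_mul]
    exact NonUnitalStarAlgHom.norm_apply_le φ (e : A)
  have h := sum_norm_sq_le_of_pairing (fun i => u (x i)) (mul_nonneg (mul_nonneg
    (mul_nonneg zero_le_four (dSK_nonneg F)) (sSup_tbSet_nonneg u)) (Real.sqrt_nonneg (sSup S)))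
    fun y => by
    have := norm_sum_pairing_le hu hFex x y (Real.sqrt_nonneg _) hx
    rwa [← mul_assoc] at this
  rwa [mul_pow, Real.sq_sqrt hS₀] at h

end
end

section
/- Let A be a commutative unital C*-algebra, let E ⊆ A be a closed subspace equipped with the induced norm, and let x₁,…,xₙ ∈ E. Then RC((xᵢ)) = max(‖∑ᵢ xᵢxᵢ*‖, ‖∑ᵢ xᵢ*xᵢ‖) equals sup{∑ᵢ |ξ(xᵢ)|² : ξ ∈ E*, ‖ξ‖ ≤ 1}, the supremum over all bounded linear functionals on E of norm at most 1. -/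
open WeakDual in
/-- The norm in a commutative unital C⋆-algebra is controlled by the values of characters. -/
theorem CommCStarAlgebra.norm_le_of_forall_character {A : Type*} [CommCStarAlgebra A] {a : A}
    {C : ℝ} (hC : 0 ≤ C) (h : ∀ φ : characterSpace ℂ A, ‖φ a‖ ≤ C) : ‖a‖ ≤ C := by
  rcases subsingleton_or_nontrivial A with _ | _
  · simpa [Subsingleton.elim a 0] using hC
  · rw [← (gelfandTransform_isometry A).norm_map_of_map_zero (map_zero _) a]
    exact (ContinuousMap.norm_le _ hC).2 h

open WeakDual in
theorem CommCStarAlgebra.norm_character_apply_le {A : Type*} [CommCStarAlgebra A]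
    (φ : characterSpace ℂ A) (a : A) : ‖φ a‖ ≤ ‖a‖ := by
  have : Nontrivial A := by
    by_contra h
    rw [not_nontrivial_iff_subsingleton] at h
    have h1 : φ (1 : A) = 1 := map_one φ
    rw [Subsingleton.elim (1 : A) 0, map_zero] at h1
    exact zero_ne_one h1
  exact spectrum.norm_le_norm_of_mem (AlgHom.apply_mem_spectrum φ a)

open WeakDual in
theorem CommCStarAlgebra.character_sum_mul_star {A ι : Type*} [CommCStarAlgebra A] [Fintype ι]
    (φ : characterSpace ℂ A) (x : ι → A) :
    φ (∑ i, x i * star (x i)) = ((∑ i, ‖φ (x i)‖ ^ 2 : ℝ) : ℂ) := by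
  simp [map_sum, map_mul, map_star, RCLike.mul_conj]

/-- Cauchy–Schwarz: a scalar combination is controlled by the row norm. -/
theorem CommCStarAlgebra.norm_sum_smul_sq_le {A ι : Type*} [CommCStarAlgebra A] [Fintype ι]
    (c : ι → ℂ) (x : ι → A) :
    ‖∑ i, c i • x i‖ ^ 2 ≤ (∑ i, ‖c i‖ ^ 2) * ‖∑ i, x i * star (x i)‖ := by
  have hnonneg : 0 ≤ (∑ i, ‖c i‖ ^ 2) * ‖∑ i, x i * star (x i)‖ := by positivity
  refine (Real.le_sqrt (norm_nonneg _) hnonneg).1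
    (norm_le_of_forall_character (Real.sqrt_nonneg _) fun φ ↦ Real.le_sqrt_of_sq_le ?_)
  have hφ : ∑ i, ‖φ (x i)‖ ^ 2 ≤ ‖∑ i, x i * star (x i)‖ := by
    have h := norm_character_apply_le φ (∑ i, x i * star (x i))
    rwa [character_sum_mul_star, Complex.norm_of_nonneg (by positivity)] at h
  have hsum : ‖φ (∑ i, c i • x i)‖ ≤ ∑ i, ‖c i‖ * ‖φ (x i)‖ := by
    simpa [map_sum, map_smul] using norm_sum_le Finset.univ fun i ↦ c i * φ (x i)
  calc ‖φ (∑ i, c i • x i)‖ ^ 2 ≤ (∑ i, ‖c i‖ * ‖φ (x i)‖) ^ 2 := by gcongr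
    _ ≤ (∑ i, ‖c i‖ ^ 2) * ∑ i, ‖φ (x i)‖ ^ 2 := Finset.sum_mul_sq_le_sq_mul_sq _ _ _
    _ ≤ _ := by gcongr

theorem CommCStarAlgebra.sum_norm_apply_sq_le {A ι : Type*} [CommCStarAlgebra A] [Fintype ι]
    {E : Submodule ℂ A} (x : ι → E) {ξ : E →L[ℂ] ℂ} (hξ : ‖ξ‖ ≤ 1) :
    ∑ i, ‖ξ (x i)‖ ^ 2 ≤ ‖∑ i, (x i : A) * star (x i : A)‖ := by
  set S := ∑ i, ‖ξ (x i)‖ ^ 2 with hS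
  have hS0 : 0 ≤ S := by positivity
  let y : E := ∑ i, star (ξ (x i)) • x i
  have hy : ξ y = (S : ℂ) := by
    simp [y, hS, map_sum, map_smul, RCLike.conj_mul]
  have hSy : S ≤ ‖(y : A)‖ := by
    have h := ξ.le_of_opNorm_le hξ y
    rwa [hy, Complex.norm_of_nonneg hS0, one_mul] at h
  have hyS : ‖(y : A)‖ ^ 2 ≤ S * ‖∑ i, (x i : A) * star (x i : A)‖ := by
    simpa [y, hS] using norm_sum_smul_sq_le (fun i ↦ star (ξ (x i))) fun i ↦ (x i : A)
  rcases hS0.eq_or_lt with h0 | hpos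
  · rw [← h0]
    positivity
  · refine le_of_mul_le_mul_left ?_ hpos
    calc S * S = S ^ 2 := (sq S).symm
      _ ≤ ‖(y : A)‖ ^ 2 := by gcongr
      _ ≤ _ := hyS


/-- Let `A` be a commutative unital C*-algebra, `E ⊆ A` a closed subspace with the induced
norm, and `x₁,…,xₙ ∈ E`.  Then `RC((xᵢ)) = max(‖∑ xᵢ xᵢ*‖, ‖∑ xᵢ* xᵢ‖)` equals
`sup{∑ |ξ(xᵢ)|² : ξ ∈ E*, ‖ξ‖ ≤ 1}`. -/
theorem rc_eq_sup_functionals {A : Type*} [CommCStarAlgebra A]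
    (E : Submodule ℂ A) (hE : IsClosed (E : Set A)) {n : ℕ} (x : Fin n → ↥E) :
    max ‖∑ i, (x i : A) * star (x i : A)‖ ‖∑ i, star (x i : A) * (x i : A)‖ =
      sSup {r : ℝ | ∃ ξ : ↥E →L[ℂ] ℂ, ‖ξ‖ ≤ 1 ∧ r = ∑ i, ‖ξ (x i)‖ ^ 2} := by
  have hcomm : ∑ i, star (x i : A) * (x i : A) = ∑ i, (x i : A) * star (x i : A) :=
    Finset.sum_congr rfl fun i _ ↦ mul_comm _ _
  rw [hcomm, max_self]
  apply le_antisymm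
  · have hbdd : BddAbove {r : ℝ | ∃ ξ : ↥E →L[ℂ] ℂ, ‖ξ‖ ≤ 1 ∧ r = ∑ i, ‖ξ (x i)‖ ^ 2} := by
      refine ⟨‖∑ i, (x i : A) * star (x i : A)‖, ?_⟩
      rintro r ⟨ξ, hξ, rfl⟩
      exact CommCStarAlgebra.sum_norm_apply_sq_le x hξ
    have hnonneg : 0 ≤ sSup {r : ℝ | ∃ ξ : ↥E →L[ℂ] ℂ, ‖ξ‖ ≤ 1 ∧ r = ∑ i, ‖ξ (x i)‖ ^ 2} := by
      apply Real.sSup_nonneg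
      rintro r ⟨ξ, -, rfl⟩
      positivity
    refine CommCStarAlgebra.norm_le_of_forall_character hnonneg fun φ ↦ ?_
    rw [CommCStarAlgebra.character_sum_mul_star, Complex.norm_of_nonneg (by positivity)]
    let ψ : A →L[ℂ] ℂ := WeakDual.CharacterSpace.toCLM φ
    refine le_csSup hbdd ⟨ψ.comp E.subtypeL, ?_, rfl⟩
    refine ContinuousLinearMap.opNorm_le_bound _ zero_le_one fun y ↦ ?_
    rw [one_mul]
    exact CommCStarAlgebra.norm_character_apply_le φ (y : A)
  · refine csSup_le ⟨0, (0 : ↥E →L[ℂ] ℂ), ContinuousLinearMap.opNorm_zero.trans_le zero_le_one, by simp⟩ ?_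
    rintro r ⟨ξ, hξ, rfl⟩
    exact CommCStarAlgebra.sum_norm_apply_sq_le x hξ
end
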